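/- arXiv:2210.07139 — 5 statements merged into one kernel-verified Lean document; each statement's English description precedes it below -/
import Mathlib

section
/- Let G be a finite simple connected graph in which every vertex is pseudo-distance-regular. Then G is distance-regular, or G is bipartite and distance-biregular. -/
open Polynomial Matrix

/-- The distance-`i` matrix of a graph: `(A_i)_{u,v} = 1` if `d(u,v) = i` and `0` otherwise. -/
noncomputable def distMatrix {V : Type*} [Fintype V] (G : SimpleGraph V) (i : ℕ) :
    Matrix V V ℝ :=
  Matrix.of fun u v => if G.dist u v = i then 1 else 0

/-- `G` has diameter `d`. -/
def IsDiam {V : Type*} (G : SimpleGraph V) (d : ℕ) : Prop :=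
  (∀ u v, G.dist u v ≤ d) ∧ ∃ u v, G.dist u v = d

/-- `u` has eccentricity `e` in `G`. -/
def IsEcc {V : Type*} (G : SimpleGraph V) (u : V) (e : ℕ) : Prop :=
  (∀ v, G.dist u v ≤ e) ∧ ∃ v, G.dist u v = e

/-- `(B, C)` is a bipartition of `G`. -/
def IsBipartition {V : Type*} (G : SimpleGraph V) (B C : Finset V) : Prop :=
  (∀ v, v ∈ B ∨ v ∈ C) ∧ (∀ v, ¬(v ∈ B ∧ v ∈ C)) ∧
    ∀ u v, G.Adj u v → ((u ∈ B ∧ v ∈ C) ∨ (u ∈ C ∧ v ∈ B))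

/-- The eigenvalue support of the vertex `u`. -/
def eSupport {V : Type*} [Fintype V] (A : Matrix V V ℝ) (u : V) : Set ℝ :=
  {θ : ℝ | ∃ w : V → ℝ, A *ᵥ w = θ • w ∧ w u ≠ 0}

/-- The vertex `u`, of eccentricity `e`, is pseudo-distance-regular. -/
def IsPseudoDistRegular {V : Type*} [Fintype V] [DecidableEq V] (G : SimpleGraph V)
    (A : Matrix V V ℝ) (u : V) (e : ℕ) : Prop :=
  (eSupport A u).ncard = e + 1 ∧
    ∀ i ≤ e, ∃ p : Polynomial ℝ, p.degree = (i : WithBot ℕ) ∧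
      ∀ w, (aeval A p *ᵥ Pi.single u 1) w ≠ 0 ↔ G.dist u w = i

/-- `G`, of diameter `d` and with adjacency matrix `A`, is distance-regular. -/
def IsDistRegular {V : Type*} [Fintype V] [DecidableEq V] (G : SimpleGraph V)
    (A : Matrix V V ℝ) (d : ℕ) : Prop :=
  (spectrum ℝ A).ncard = d + 1 ∧
    ∀ i ≤ d, ∃ p : Polynomial ℝ, p.degree = (i : WithBot ℕ) ∧ aeval A p = distMatrix G i

/-- `G` with bipartition `(B,C)`, adjacency matrix `A` and diameter `d` is distance-biregular. -/
def IsDistBiregular {V : Type*} [Fintype V] [DecidableEq V] (G : SimpleGraph V)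
    (A : Matrix V V ℝ) (B C : Finset V) (d : ℕ) : Prop :=
  (spectrum ℝ A).ncard = d + 1 ∧
    ∃ pB pC : ℕ → Polynomial ℝ, ∀ i ≤ d,
      (pB i).degree = (i : WithBot ℕ) ∧ (pC i).degree = (i : WithBot ℕ) ∧
      (∀ b ∈ B, aeval A (pB i) *ᵥ Pi.single b 1 = distMatrix G i *ᵥ Pi.single b 1) ∧
      (∀ c ∈ C, aeval A (pC i) *ᵥ Pi.single c 1 = distMatrix G i *ᵥ Pi.single c 1)

section SymmetricMatrix

variable {V : Type*} [Fintype V] [DecidableEq V] {A : Matrix V V ℝ}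

lemma aeval_apply_comm (hA : A.IsSymm) (p : ℝ[X]) (u w : V) :
    aeval A p u w = aeval A p w u := by
  have h : (aeval A p)ᵀ = aeval A p := by
    induction p using Polynomial.induction_on' with
    | add p q hp hq => rw [map_add, Matrix.transpose_add, hp, hq]
    | monomial n a =>
      rw [aeval_monomial, ← Algebra.smul_def, Matrix.transpose_smul, Matrix.transpose_pow, hA.eq]
  exact congrFun (congrFun h w) u

lemma aeval_mul_apply_self (hA : A.IsSymm) (p q : ℝ[X]) (u : V) :
    aeval A (p * q) u u = ∑ w, aeval A p w u * aeval A q w u := by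
  rw [map_mul, Matrix.mul_apply]
  exact Finset.sum_congr rfl fun w _ => by rw [aeval_apply_comm hA p u w]

lemma aeval_apply_eq_zero_of_mul_self (hA : A.IsSymm) {p : ℝ[X]} {u : V}
    (h : aeval A (p * p) u u = 0) (w : V) : aeval A p w u = 0 := by
  rw [aeval_mul_apply_self hA,
    Finset.sum_eq_zero_iff_of_nonneg fun _ _ => mul_self_nonneg _] at h
  exact mul_self_eq_zero.mp (h w (Finset.mem_univ w))

lemma aeval_mulVec_of_eigen {x : V → ℝ} {θ : ℝ} (hx : A *ᵥ x = θ • x) (p : ℝ[X]) :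
    aeval A p *ᵥ x = p.eval θ • x := by
  induction p using Polynomial.induction_on with
  | C a =>
    rw [aeval_C, eval_C, Algebra.algebraMap_eq_smul_one, Matrix.smul_mulVec, Matrix.one_mulVec]
  | add p q hp hq => rw [map_add, Matrix.add_mulVec, hp, hq, eval_add, add_smul]
  | monomial n a h =>
    rw [pow_succ, ← mul_assoc, map_mul, aeval_X, ← Matrix.mulVec_mulVec, hx, Matrix.mulVec_smul, h,
      smul_smul, mul_comm, ← eval_mul_X]

lemma sum_mul_aeval_of_eigen (hA : A.IsSymm) {x : V → ℝ} {θ : ℝ} (hx : A *ᵥ x = θ • x)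
    (p : ℝ[X]) (u : V) : ∑ w, aeval A p w u * x w = p.eval θ * x u := by
  have h := congrFun (aeval_mulVec_of_eigen hx p) u
  simp only [Matrix.mulVec, dotProduct, Pi.smul_apply, smul_eq_mul] at h
  rw [← h]
  exact Finset.sum_congr rfl fun w _ => by rw [aeval_apply_comm hA]

lemma eq_zero_of_orthogonal_eigenvectors (hA : A.IsSymm) (f : V → ℝ)
    (hf : ∀ (θ : ℝ) (x : V → ℝ), A *ᵥ x = θ • x → ∑ w, f w * x w = 0) : f = 0 := by
  have hH : A.IsHermitian := by
    rw [Matrix.IsHermitian, Matrix.conjTranspose_eq_transpose_of_trivial]; exact hA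
  have h : WithLp.toLp 2 f = 0 := by
    refine hH.eigenvectorBasis.repr.injective (PiLp.ext fun j => ?_)
    rw [OrthonormalBasis.repr_apply_apply, map_zero]
    simpa [PiLp.inner_apply] using hf _ _ (hH.mulVec_eigenvectorBasis j)
  simpa using congrArg WithLp.ofLp h

lemma mem_spectrum_iff_exists_eigenvector {θ : ℝ} :
    θ ∈ spectrum ℝ A ↔ ∃ x : V → ℝ, x ≠ 0 ∧ A *ᵥ x = θ • x := by
  rw [← Matrix.spectrum_toLin', ← Module.End.hasEigenvalue_iff_mem_spectrum]
  constructor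
  · intro h
    obtain ⟨x, hx⟩ := h.exists_hasEigenvector
    exact ⟨x, hx.2, by simpa using hx.apply_eq_smul⟩
  · rintro ⟨x, hx0, hx⟩
    exact Module.End.hasEigenvalue_of_hasEigenvector
      (Module.End.hasEigenvector_iff.mpr ⟨Module.End.mem_eigenspace_iff.mpr (by simpa using hx), hx0⟩)

lemma mem_spectrum_iff_exists_mem_eSupport {θ : ℝ} :
    θ ∈ spectrum ℝ A ↔ ∃ u, θ ∈ eSupport A u := by
  rw [mem_spectrum_iff_exists_eigenvector]
  constructor
  · rintro ⟨x, hx0, hx⟩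
    obtain ⟨u, hu⟩ := Function.ne_iff.mp hx0
    exact ⟨u, x, hx, hu⟩
  · rintro ⟨u, x, hx, hu⟩
    exact ⟨x, fun h => hu (by simp [h]), hx⟩

lemma finite_eSupport (A : Matrix V V ℝ) (u : V) : (eSupport A u).Finite :=
  (Module.End.finite_spectrum A.toLin').subset fun _ hθ => by
    rw [Matrix.spectrum_toLin']
    exact mem_spectrum_iff_exists_mem_eSupport.mpr ⟨u, hθ⟩

/-- The monic polynomial whose roots are the eigenvalues in the support of `u`. -/
noncomputable def supportPoly (A : Matrix V V ℝ) (u : V) : ℝ[X] :=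
  ∏ θ ∈ (finite_eSupport A u).toFinset, (X - C θ)

lemma eval_supportPoly_eq_zero_iff {u : V} {θ : ℝ} :
    (supportPoly A u).eval θ = 0 ↔ θ ∈ eSupport A u := by
  rw [supportPoly, eval_prod, Finset.prod_eq_zero_iff]
  simp [sub_eq_zero]

lemma supportPoly_monic (u : V) : (supportPoly A u).Monic :=
  monic_prod_of_monic _ _ fun θ _ => monic_X_sub_C θ

lemma natDegree_supportPoly (u : V) : (supportPoly A u).natDegree = (eSupport A u).ncard := by
  rw [supportPoly, natDegree_prod_of_monic _ _ fun θ _ => monic_X_sub_C θ,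
    Set.ncard_eq_toFinset_card _ (finite_eSupport A u)]
  simp

lemma exists_supportPoly_eq_mul {u : V} {θ : ℝ} (hθ : θ ∈ eSupport A u) :
    ∃ r : ℝ[X], supportPoly A u = (X - C θ) * r ∧ r.eval θ ≠ 0 := by
  refine ⟨_, (Finset.mul_prod_erase _ _ ((finite_eSupport A u).mem_toFinset.mpr hθ)).symm, ?_⟩
  rw [eval_prod, Finset.prod_ne_zero_iff]
  intro μ hμ
  simpa [sub_eq_zero] using (Finset.ne_of_mem_erase hμ).symm

lemma aeval_mul_apply_eq_zero {q : ℝ[X]} {u : V} (hq : ∀ w, aeval A q w u = 0) (p : ℝ[X]) (w : V) :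
    aeval A (p * q) w u = 0 := by
  simp [Matrix.mul_apply, hq]

lemma aeval_C_mul_apply (a : ℝ) (p : ℝ[X]) (w u : V) :
    aeval A (C a * p) w u = a * aeval A p w u := by
  rw [← smul_eq_C_mul, map_smul, Matrix.smul_apply, smul_eq_mul]

lemma aeval_supportPoly_apply (hA : A.IsSymm) (u w : V) :
    aeval A (supportPoly A u) w u = 0 := by
  refine congrFun (eq_zero_of_orthogonal_eigenvectors hA
    (fun w => aeval A (supportPoly A u) w u) fun θ x hx => ?_) w
  rw [sum_mul_aeval_of_eigen hA hx]
  by_cases hu : x u = 0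
  · rw [hu, mul_zero]
  · rw [eval_supportPoly_eq_zero_iff.mpr ⟨x, hx, hu⟩, zero_mul]

lemma eval_eq_zero_of_aeval_apply_eq_zero (hA : A.IsSymm) {p : ℝ[X]} {u : V}
    (hp : ∀ w, aeval A p w u = 0) {θ : ℝ} (hθ : θ ∈ eSupport A u) : p.eval θ = 0 := by
  obtain ⟨x, hx, hxu⟩ := hθ
  have h := sum_mul_aeval_of_eigen hA hx p u
  simp only [hp, zero_mul, Finset.sum_const_zero] at h
  exact (mul_eq_zero.mp h.symm).resolve_right hxu

end SymmetricMatrix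

lemma exists_eq_sum_of_degree_lt {P : ℕ → ℝ[X]} {n : ℕ}
    (hP : ∀ i < n, (P i).degree = (i : WithBot ℕ)) {p : ℝ[X]} (hp : p.degree < (n : WithBot ℕ)) :
    ∃ c : ℕ → ℝ, p = ∑ j ∈ Finset.range n, C (c j) * P j := by
  induction n generalizing p with
  | zero =>
    refine ⟨0, ?_⟩
    simpa [Nat.WithBot.lt_zero_iff] using hp
  | succ n ih =>
    have hn := hP n n.lt_succ_self
    have hlead : (P n).coeff n ≠ 0 := coeff_ne_zero_of_eq_degree hn
    obtain ⟨c, hc⟩ := ih (fun i hi => hP i (hi.trans n.lt_succ_self))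
      (p := p - C (p.coeff n / (P n).coeff n) * P n) (by
        rw [degree_lt_iff_coeff_zero] at hp ⊢
        intro m (hm : n ≤ m)
        rw [coeff_sub, coeff_C_mul]
        rcases hm.eq_or_lt with rfl | hlt
        · field_simp
          ring
        · rw [hp m hlt, coeff_eq_zero_of_degree_lt (p := P n) (n := m)
            (hn.trans_lt (by exact_mod_cast hlt))]
          simp)
    refine ⟨Function.update c n (p.coeff n / (P n).coeff n), ?_⟩
    rw [Finset.sum_range_succ, Function.update_self, ← sub_eq_iff_eq_add, hc]
    refine Finset.sum_congr rfl fun j hj => ?_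
    rw [Function.update_of_ne (Finset.mem_range.mp hj).ne]


section PerronVector

variable {V : Type*} [Fintype V] {G : SimpleGraph V} [DecidableRel G.Adj]

lemma eq_zero_of_nonneg_eigenvector (hconn : G.Connected) {z : V → ℝ} {θ : ℝ}
    (hz : G.adjMatrix ℝ *ᵥ z = θ • z) (hnonneg : ∀ x, 0 ≤ z x) {u : V} (hu : z u = 0) : z = 0 := by
  have key : ∀ {a b : V}, G.Walk a b → z a = 0 → z b = 0 := by
    intro a b p
    induction p with
    | nil => exact id
    | @cons a y b hadj _ ih =>
      intro ha
      refine ih ?_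
      have h := congrFun hz a
      rw [SimpleGraph.adjMatrix_mulVec_apply, Pi.smul_apply, ha, smul_zero,
        Finset.sum_eq_zero_iff_of_nonneg fun _ _ => hnonneg _] at h
      exact h y (by simpa using hadj)
  funext b
  exact key (hconn.preconnected u b).some hu

lemma exists_max_rayleigh [Nonempty V] (A : Matrix V V ℝ) :
    ∃ x : V → ℝ, x ≠ 0 ∧ ∃ θ : ℝ, x ⬝ᵥ A *ᵥ x = θ * (x ⬝ᵥ x) ∧
      ∀ y : V → ℝ, y ⬝ᵥ A *ᵥ y ≤ θ * (y ⬝ᵥ y) := by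
  classical
  have hcont : Continuous fun x : V → ℝ => x ⬝ᵥ A *ᵥ x := by
    simp only [dotProduct, Matrix.mulVec]; fun_prop
  have hcompact : IsCompact {x : V → ℝ | x ⬝ᵥ x = 1} := by
    refine Metric.isCompact_of_isClosed_isBounded
      (isClosed_eq (by simp only [dotProduct]; fun_prop) continuous_const) ?_
    refine (Metric.isBounded_closedBall (x := (0 : V → ℝ)) (r := 1)).subset fun x hx => ?_
    rw [mem_closedBall_zero_iff, pi_norm_le_iff_of_nonneg zero_le_one]
    intro i
    rw [Real.norm_eq_abs, ← sq_le_one_iff_abs_le_one, ← (show x ⬝ᵥ x = 1 from hx), pow_two]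
    exact Finset.single_le_sum (f := fun i => x i * x i) (fun _ _ => mul_self_nonneg _)
      (Finset.mem_univ i)
  obtain ⟨i⟩ := ‹Nonempty V›
  obtain ⟨x, hx, hmax⟩ := hcompact.exists_isMaxOn
    ⟨Pi.single i 1, by simp⟩ hcont.continuousOn
  have hx1 : x ⬝ᵥ x = 1 := hx
  refine ⟨x, fun h => by simp [h] at hx1, x ⬝ᵥ A *ᵥ x, by rw [hx1, mul_one], fun y => ?_⟩
  rcases eq_or_ne y 0 with rfl | hy
  · simp
  · have hpos : 0 < y ⬝ᵥ y := by
      refine lt_of_le_of_ne (Finset.sum_nonneg fun _ _ => mul_self_nonneg _) fun h => hy ?_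
      exact dotProduct_self_eq_zero.mp h.symm
    set s := Real.sqrt (y ⬝ᵥ y) with hs
    have hs0 : s ≠ 0 := (Real.sqrt_pos.mpr hpos).ne'
    have hss : s * s = y ⬝ᵥ y := Real.mul_self_sqrt hpos.le
    have h := hmax (show (s⁻¹ • y) ⬝ᵥ (s⁻¹ • y) = 1 by
      rw [smul_dotProduct, dotProduct_smul, ← hss]; simp; field_simp)
    simp only [Set.mem_ofPred_eq, Matrix.mulVec_smul, smul_dotProduct, dotProduct_smul,
      smul_eq_mul] at h
    rw [← hss]
    calc y ⬝ᵥ A *ᵥ y = (s⁻¹ * (s⁻¹ * (y ⬝ᵥ A *ᵥ y))) * (s * s) := by field_simp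
      _ ≤ _ := mul_le_mul_of_nonneg_right h (mul_self_nonneg s)

lemma exists_pos_eigenvector (hconn : G.Connected) :
    ∃ (lam : ℝ) (ν : V → ℝ), (∀ x, 0 < ν x) ∧ G.adjMatrix ℝ *ᵥ ν = lam • ν := by
  classical
  have := hconn.nonempty
  obtain ⟨x, hx0, lam, hx, hmax⟩ := exists_max_rayleigh (G.adjMatrix ℝ)
  have hform (y : V → ℝ) : y ⬝ᵥ (lam • (1 : Matrix V V ℝ) - G.adjMatrix ℝ) *ᵥ y =
      lam * (y ⬝ᵥ y) - y ⬝ᵥ G.adjMatrix ℝ *ᵥ y := by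
    rw [Matrix.sub_mulVec, dotProduct_sub, Matrix.smul_mulVec, Matrix.one_mulVec, dotProduct_smul,
      smul_eq_mul]
  have hpsd : (lam • (1 : Matrix V V ℝ) - G.adjMatrix ℝ).PosSemidef := by
    refine Matrix.PosSemidef.of_dotProduct_mulVec_nonneg ?_ fun y => ?_
    · rw [Matrix.IsHermitian, Matrix.conjTranspose_eq_transpose_of_trivial]; simp
    · rw [star_trivial, hform]
      linarith [hmax y]
  have habs : |x| ⬝ᵥ |x| = x ⬝ᵥ x := by simp [dotProduct]
  have hle : x ⬝ᵥ G.adjMatrix ℝ *ᵥ x ≤ |x| ⬝ᵥ G.adjMatrix ℝ *ᵥ |x| := by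
    simp only [dotProduct, SimpleGraph.adjMatrix_mulVec_apply]
    refine Finset.sum_le_sum fun i _ => (le_abs_self _).trans ?_
    rw [abs_mul]
    exact mul_le_mul_of_nonneg_left (Finset.abs_sum_le_sum_abs _ _) (abs_nonneg _)
  have hzero := (hpsd.dotProduct_mulVec_zero_iff |x|).mp (by
    rw [star_trivial, hform]
    linarith [hmax |x|, hmax x, habs ▸ hx])
  rw [Matrix.sub_mulVec, Matrix.smul_mulVec, Matrix.one_mulVec, sub_eq_zero] at hzero
  refine ⟨lam, |x|, fun u => lt_of_le_of_ne (abs_nonneg _) fun h => hx0 ?_, hzero.symm⟩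
  exact funext fun w => abs_eq_zero.mp (congrFun
    (eq_zero_of_nonneg_eigenvector hconn hzero.symm (fun _ => abs_nonneg _) h.symm) w)

lemma eq_smul_of_eigenvector (hconn : G.Connected) {lam : ℝ} {ν y : V → ℝ} (hpos : ∀ x, 0 < ν x)
    (hν : G.adjMatrix ℝ *ᵥ ν = lam • ν) (hy : G.adjMatrix ℝ *ᵥ y = lam • y) :
    ∃ t : ℝ, y = t • ν := by
  have := hconn.nonempty
  obtain ⟨x₀, hx₀⟩ := Finite.exists_min fun x => y x / ν x
  refine ⟨y x₀ / ν x₀, sub_eq_zero.mp (eq_zero_of_nonneg_eigenvector hconn (θ := lam) (u := x₀)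
    ?_ (fun x => ?_) ?_)⟩
  · rw [Matrix.mulVec_sub, Matrix.mulVec_smul, hν, hy, smul_sub, smul_comm]
  · have := hx₀ x
    rw [le_div_iff₀ (hpos x)] at this
    simpa using this
  · simp [(hpos x₀).ne']

end PerronVector

lemma exists_isEcc {V : Type*} [Finite V] [Nonempty V] (G : SimpleGraph V) (u : V) :
    ∃ e, IsEcc G u e := by
  obtain ⟨y, hy⟩ := Finite.exists_max (G.dist u)
  exact ⟨_, hy, y, rfl⟩

lemma exists_dist_eq_of_isEcc {V : Type*} {G : SimpleGraph V} (hconn : G.Connected)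
    {u : V} {e i : ℕ} (hecc : IsEcc G u e) (hi : i ≤ e) : ∃ y, G.dist u y = i := by
  obtain ⟨z, hz⟩ := hecc.2
  obtain ⟨p, hp⟩ := hconn.exists_walk_length_eq_dist u z
  refine ⟨p.getVert i, ?_⟩
  have h1 := G.dist_le (p.take i)
  have h2 := G.dist_le (p.drop i)
  have h3 := hconn.dist_triangle (u := u) (v := p.getVert i) (w := z)
  rw [SimpleGraph.Walk.take_length] at h1
  rw [SimpleGraph.Walk.drop_length] at h2
  omega

section PseudoDistanceRegular

variable {V : Type*} [Fintype V] [DecidableEq V] {G : SimpleGraph V} [DecidableRel G.Adj]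

lemma exists_aeval_apply_eq_mul_of_isPseudoDistRegular {u : V} {e : ℕ} (hecc : IsEcc G u e)
    {P : ℕ → ℝ[X]} (hcard : (eSupport (G.adjMatrix ℝ) u).ncard = e + 1)
    (hdeg : ∀ i ≤ e, (P i).degree = (i : WithBot ℕ))
    (hsupp : ∀ i ≤ e, ∀ w, aeval (G.adjMatrix ℝ) (P i) w u ≠ 0 ↔ G.dist u w = i) (p : ℝ[X]) :
    ∃ c : ℕ → ℝ, ∀ w, aeval (G.adjMatrix ℝ) p w u =
      c (G.dist u w) * aeval (G.adjMatrix ℝ) (P (G.dist u w)) w u := by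
  set A := G.adjMatrix ℝ
  have hA : A.IsSymm := G.isSymm_adjMatrix
  have hmonic := supportPoly_monic (A := A) u
  obtain ⟨c, hc⟩ := exists_eq_sum_of_degree_lt (P := P) (n := e + 1)
    (fun i hi => hdeg i (Nat.lt_succ_iff.mp hi)) (p := p %ₘ supportPoly A u) (by
      rw [← hcard, ← natDegree_supportPoly, ← degree_eq_natDegree hmonic.ne_zero]
      exact degree_modByMonic_lt p hmonic)
  refine ⟨c, fun w => ?_⟩
  conv_lhs => rw [← modByMonic_add_div p (supportPoly A u), mul_comm, map_add, Matrix.add_apply,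
    aeval_mul_apply_eq_zero (aeval_supportPoly_apply hA u), add_zero, hc, map_sum, Matrix.sum_apply]
  simp only [aeval_C_mul_apply]
  refine Finset.sum_eq_single_of_mem _
    (Finset.mem_range.mpr (Nat.lt_succ_iff.mpr (hecc.1 w))) fun j hj hne => ?_
  have h := mt (hsupp j (Nat.lt_succ_iff.mp (Finset.mem_range.mp hj)) w).mp hne.symm
  rw [not_not.mp h, mul_zero]

lemma exists_aeval_apply_eq_mul_pos_eigenvector (hconn : G.Connected) {lam : ℝ} {ν : V → ℝ}
    (hpos : ∀ x, 0 < ν x) (hν : G.adjMatrix ℝ *ᵥ ν = lam • ν) {u : V} {e : ℕ} (hecc : IsEcc G u e)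
    (hu : IsPseudoDistRegular G (G.adjMatrix ℝ) u e) (p : ℝ[X]) :
    ∃ c : ℕ → ℝ, ∀ w, aeval (G.adjMatrix ℝ) p w u = c (G.dist u w) * ν w := by
  obtain ⟨hcard, hex⟩ := hu
  simp only [Matrix.mulVec_single_one, Matrix.col_apply] at hex
  choose! P hdeg hsupp using hex
  have hspan := exists_aeval_apply_eq_mul_of_isPseudoDistRegular hecc hcard hdeg hsupp
  set A := G.adjMatrix ℝ
  have hA : A.IsSymm := G.isSymm_adjMatrix
  obtain ⟨r, hr, hr0⟩ := exists_supportPoly_eq_mul (A := A) (u := u) ⟨ν, hν, (hpos u).ne'⟩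
  obtain ⟨t, ht⟩ := eq_smul_of_eigenvector hconn hpos hν (y := fun w => aeval A r w u) (by
    funext w
    have h := aeval_supportPoly_apply hA u w
    rw [hr, map_mul, map_sub, aeval_X, aeval_C, Algebra.algebraMap_eq_smul_one, sub_mul,
      Matrix.sub_apply, Matrix.smul_mul, one_mul, sub_eq_zero] at h
    rw [Matrix.mul_apply] at h
    exact h)
  have ht0 : t ≠ 0 := by
    rintro rfl
    have h := sum_mul_aeval_of_eigen hA hν r u
    have h0 (w : V) : aeval A r w u = 0 := by simpa using congrFun ht w
    simp only [h0, zero_mul, Finset.sum_const_zero] at h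
    exact mul_ne_zero hr0 (hpos u).ne' h.symm
  obtain ⟨c, hc⟩ := hspan p
  obtain ⟨b, hb⟩ := hspan r
  refine ⟨fun i => c i * (t / b i), fun w => ?_⟩
  have htw : t * ν w = b (G.dist u w) * aeval A (P (G.dist u w)) w u := by
    rw [← hb]; exact (congrFun ht w).symm
  have hb0 : b (G.dist u w) ≠ 0 := by
    intro h0
    rw [h0, zero_mul] at htw
    exact mul_ne_zero ht0 (hpos w).ne' htw
  rw [hc, mul_assoc, div_mul_eq_mul_div, htw, mul_div_cancel_left₀ _ hb0]

end PseudoDistanceRegular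

/-- On each sphere around each vertex `u`, every vector `p(A) e_u` is proportional to `ν`. -/
def IsSphereProportional {V : Type*} [Fintype V] [DecidableEq V] (G : SimpleGraph V)
    [DecidableRel G.Adj] (ν : V → ℝ) : Prop :=
  ∀ (u : V) (p : ℝ[X]), ∃ c : ℕ → ℝ, ∀ w, aeval (G.adjMatrix ℝ) p w u = c (G.dist u w) * ν w

section SphereProportional

variable {V : Type*} [Fintype V] [DecidableEq V] {G : SimpleGraph V} [DecidableRel G.Adj]
  {lam : ℝ} {ν : V → ℝ}

lemma mul_aeval_X_mul_apply_self (hν : G.adjMatrix ℝ *ᵥ ν = lam • ν)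
    (hloc : IsSphereProportional G ν)
    {u w : V} (huw : G.Adj u w) (p : ℝ[X]) :
    ν w * aeval (G.adjMatrix ℝ) (X * p) u u = lam * ν u * aeval (G.adjMatrix ℝ) p w u := by
  obtain ⟨c, hc⟩ := hloc u p
  have hnbr {x : V} (hx : G.Adj u x) : aeval (G.adjMatrix ℝ) p x u = c 1 * ν x := by
    rw [hc, SimpleGraph.dist_eq_one_iff_adj.mpr hx]
  have hsum := congrFun hν u
  rw [SimpleGraph.adjMatrix_mulVec_apply, Pi.smul_apply, smul_eq_mul] at hsum
  rw [map_mul, aeval_X, SimpleGraph.adjMatrix_mul_apply, hnbr huw, ← hsum,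
    Finset.sum_congr rfl fun x hx => hnbr ((G.mem_neighborFinset u x).mp hx), ← Finset.mul_sum]
  ring

lemma sq_mul_aeval_X_mul_apply_self (hconn : G.Connected) (hpos : ∀ x, 0 < ν x)
    (hν : G.adjMatrix ℝ *ᵥ ν = lam • ν)
    (hloc : IsSphereProportional G ν) (p : ℝ[X]) (u w : V) :
    ν w ^ 2 * aeval (G.adjMatrix ℝ) (X * p) u u =
      ν u ^ 2 * aeval (G.adjMatrix ℝ) (X * p) w w := by
  induction (hconn.preconnected u w).some with
  | nil => rfl
  | @cons u v w huv _ ih =>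
    have h1 := mul_aeval_X_mul_apply_self hν hloc huv p
    have h2 := mul_aeval_X_mul_apply_self hν hloc huv.symm p
    rw [aeval_apply_comm G.isSymm_adjMatrix p u v] at h2
    refine mul_left_cancel₀ (pow_ne_zero 2 (hpos v).ne') ?_
    linear_combination (ν w ^ 2 * ν v) * h1 - (ν w ^ 2 * ν u) * h2 + ν u ^ 2 * ih

lemma aeval_apply_self_eq (hconn : G.Connected) (hpos : ∀ x, 0 < ν x)
    (hν : G.adjMatrix ℝ *ᵥ ν = lam • ν)
    (hloc : IsSphereProportional G ν) {u u' : V} (huu' : ν u = ν u')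
    (p : ℝ[X]) : aeval (G.adjMatrix ℝ) p u u = aeval (G.adjMatrix ℝ) p u' u' := by
  have h := sq_mul_aeval_X_mul_apply_self hconn hpos hν hloc p.divX u u'
  rw [huu'] at h
  have h' := mul_left_cancel₀ (pow_ne_zero 2 (hpos u').ne') h
  rw [← divX_mul_X_add p, mul_comm p.divX, map_add, Matrix.add_apply, Matrix.add_apply, h', aeval_C,
    Matrix.algebraMap_matrix_apply, Matrix.algebraMap_matrix_apply, if_pos rfl, if_pos rfl]

lemma eq_of_adj_of_eq (hconn : G.Connected) (hpos : ∀ x, 0 < ν x)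
    (hν : G.adjMatrix ℝ *ᵥ ν = lam • ν)
    (hloc : IsSphereProportional G ν) {u u' w w' : V} (huu' : ν u = ν u')
    (huw : G.Adj u w) (huw' : G.Adj u' w') : ν w = ν w' := by
  have h1 := mul_aeval_X_mul_apply_self hν hloc huw X
  have h2 := mul_aeval_X_mul_apply_self hν hloc huw' X
  have hsq : aeval (G.adjMatrix ℝ) (X * X) u u ≠ 0 := fun h => by
    have := aeval_apply_eq_zero_of_mul_self G.isSymm_adjMatrix h w
    simp [huw.symm] at this
  rw [← aeval_apply_self_eq hconn hpos hν hloc huu', ← huu'] at h2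
  refine mul_right_cancel₀ hsq (h1.trans (Eq.trans ?_ h2.symm))
  simp [huw.symm, huw'.symm]

lemma eq_of_dist_eq (hconn : G.Connected) (hpos : ∀ x, 0 < ν x)
    (hν : G.adjMatrix ℝ *ᵥ ν = lam • ν)
    (hloc : IsSphereProportional G ν) {u u' w w' : V} (huu' : ν u = ν u')
    (hdist : G.dist u w = G.dist u' w') : ν w = ν w' := by
  have key : ∀ {a b : V} (p : G.Walk a b) {a' b' : V} (p' : G.Walk a' b'),
      p.length = p'.length → ν a = ν a' → ν b = ν b' := by
    intro a b p
    induction p with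
    | nil =>
      intro a' b' p' hlen haa'
      cases p' with
      | nil => exact haa'
      | cons _ _ => simp at hlen
    | cons hadj p ih =>
      intro a' b' p' hlen haa'
      cases p' with
      | nil => simp at hlen
      | cons hadj' p' =>
        exact ih p' (by simpa using hlen) (eq_of_adj_of_eq hconn hpos hν hloc haa' hadj hadj')
  obtain ⟨p, hp⟩ := hconn.exists_walk_length_eq_dist u w
  obtain ⟨p', hp'⟩ := hconn.exists_walk_length_eq_dist u' w'
  exact key p p' (by rw [hp, hp', hdist]) huu'

lemma exists_aeval_apply_eq_dist_indicator (hconn : G.Connected) (hpos : ∀ x, 0 < ν x)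
    (hν : G.adjMatrix ℝ *ᵥ ν = lam • ν)
    (hloc : IsSphereProportional G ν)
    {u : V} {e i : ℕ} (hecc : IsEcc G u e) (hu : IsPseudoDistRegular G (G.adjMatrix ℝ) u e)
    (hi : i ≤ e) :
    ∃ f : ℝ[X], f.degree = (i : WithBot ℕ) ∧
      ∀ w, aeval (G.adjMatrix ℝ) f w u = if G.dist u w = i then 1 else 0 := by
  obtain ⟨p, hdeg, hp⟩ := hu.2 i hi
  simp only [Matrix.mulVec_single_one, Matrix.col_apply] at hp
  obtain ⟨c, hc⟩ := hloc u p
  obtain ⟨y, hy⟩ := exists_dist_eq_of_isEcc hconn hecc hi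
  have hsphere {w : V} (hw : G.dist u w = i) :
      aeval (G.adjMatrix ℝ) p w u = aeval (G.adjMatrix ℝ) p y u := by
    rw [hc, hc, hw, hy, eq_of_dist_eq hconn hpos hν hloc (u := u) rfl (hw.trans hy.symm)]
  have hne := (hp y).mpr hy
  refine ⟨C (aeval (G.adjMatrix ℝ) p y u)⁻¹ * p, ?_, fun w => ?_⟩
  · rw [degree_C_mul (inv_ne_zero hne), hdeg]
  · rw [aeval_C_mul_apply]
    split_ifs with hw
    · rw [hsphere hw, inv_mul_cancel₀ hne]
    · rw [not_not.mp (mt (hp w).mp hw), mul_zero]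

lemma aeval_apply_eq_zero_of_eq (hconn : G.Connected) (hpos : ∀ x, 0 < ν x)
    (hν : G.adjMatrix ℝ *ᵥ ν = lam • ν)
    (hloc : IsSphereProportional G ν) {u u' : V} (huu' : ν u = ν u')
    {p : ℝ[X]} (hp : ∀ w, aeval (G.adjMatrix ℝ) p w u = 0) (w : V) :
    aeval (G.adjMatrix ℝ) p w u' = 0 := by
  refine aeval_apply_eq_zero_of_mul_self G.isSymm_adjMatrix ?_ w
  rw [← aeval_apply_self_eq hconn hpos hν hloc huu', aeval_mul_apply_eq_zero hp]

lemma eSupport_subset_insert_zero (hconn : G.Connected) (hpos : ∀ x, 0 < ν x)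
    (hν : G.adjMatrix ℝ *ᵥ ν = lam • ν)
    (hloc : IsSphereProportional G ν) (u w : V) :
    eSupport (G.adjMatrix ℝ) w ⊆ insert 0 (eSupport (G.adjMatrix ℝ) u) := by
  intro θ hθ
  set q := supportPoly (G.adjMatrix ℝ) u
  have hq : ∀ x, aeval (G.adjMatrix ℝ) q x u = 0 := aeval_supportPoly_apply G.isSymm_adjMatrix u
  have hsq : aeval (G.adjMatrix ℝ) ((X * q) * (X * q)) w w = 0 := by
    have h := sq_mul_aeval_X_mul_apply_self hconn hpos hν hloc (X * q * q) u w
    rw [show X * (X * q * q) = X * q * (X * q) by ring] at h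
    rw [← mul_assoc, aeval_mul_apply_eq_zero hq, mul_zero, mul_assoc] at h
    exact (mul_eq_zero.mp h.symm).resolve_left (pow_ne_zero 2 (hpos u).ne')
  have h := eval_eq_zero_of_aeval_apply_eq_zero G.isSymm_adjMatrix
    (aeval_apply_eq_zero_of_mul_self G.isSymm_adjMatrix hsq) hθ
  rw [eval_mul, eval_X, mul_eq_zero] at h
  exact h.imp id eval_supportPoly_eq_zero_iff.mp

lemma eSupport_eq_of_eq (hconn : G.Connected) (hpos : ∀ x, 0 < ν x)
    (hν : G.adjMatrix ℝ *ᵥ ν = lam • ν)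
    (hloc : IsSphereProportional G ν) {u u' : V} (huu' : ν u = ν u') :
    eSupport (G.adjMatrix ℝ) u = eSupport (G.adjMatrix ℝ) u' := by
  have key : ∀ {a b : V}, ν a = ν b →
      eSupport (G.adjMatrix ℝ) b ⊆ eSupport (G.adjMatrix ℝ) a := fun hab _ hθ =>
    eval_supportPoly_eq_zero_iff.mp (eval_eq_zero_of_aeval_apply_eq_zero G.isSymm_adjMatrix
      (aeval_apply_eq_zero_of_eq hconn hpos hν hloc hab
        (aeval_supportPoly_apply G.isSymm_adjMatrix _)) hθ)
  exact (key huu'.symm).antisymm (key huu')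

lemma exists_spectrum_eq_eSupport (hconn : G.Connected) (hpos : ∀ x, 0 < ν x)
    (hν : G.adjMatrix ℝ *ᵥ ν = lam • ν)
    (hloc : IsSphereProportional G ν) :
    ∃ u, spectrum ℝ (G.adjMatrix ℝ) = eSupport (G.adjMatrix ℝ) u := by
  have key (u : V) (h0 : 0 ∈ spectrum ℝ (G.adjMatrix ℝ) → 0 ∈ eSupport (G.adjMatrix ℝ) u) :
      spectrum ℝ (G.adjMatrix ℝ) = eSupport (G.adjMatrix ℝ) u := by
    refine Set.Subset.antisymm (fun θ hθ => ?_) fun θ hθ =>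
      mem_spectrum_iff_exists_mem_eSupport.mpr ⟨u, hθ⟩
    obtain ⟨w, hw⟩ := mem_spectrum_iff_exists_mem_eSupport.mp hθ
    rcases eSupport_subset_insert_zero hconn hpos hν hloc u w hw with rfl | h
    · exact h0 hθ
    · exact h
  by_cases h : 0 ∈ spectrum ℝ (G.adjMatrix ℝ)
  · obtain ⟨u, hu⟩ := mem_spectrum_iff_exists_mem_eSupport.mp h
    exact ⟨u, key u fun _ => hu⟩
  · exact ⟨hconn.nonempty.some, key _ fun h' => absurd h' h⟩

lemma aeval_apply_eq_zero_of_degree_lt_dist {p : ℝ[X]} {u w : V}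
    (hp : p.degree < (G.dist u w : WithBot ℕ)) : aeval (G.adjMatrix ℝ) p w u = 0 := by
  rw [aeval_eq_sum_range, Matrix.sum_apply]
  refine Finset.sum_eq_zero fun n _ => ?_
  rw [Matrix.smul_apply, smul_eq_mul, mul_eq_zero, or_iff_not_imp_left]
  intro hn
  have hlt : n < G.dist u w := by
    by_contra! hle
    exact hn (coeff_eq_zero_of_degree_lt (hp.trans_le (by exact_mod_cast hle)))
  rw [SimpleGraph.adjMatrix_pow_apply_eq_card_walk, Nat.cast_eq_zero, Fintype.card_eq_zero_iff]
  refine ⟨fun q => ?_⟩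
  have hq := G.dist_le q.1
  have hlen : q.1.length = n := q.2
  rw [SimpleGraph.dist_comm, hlen] at hq
  omega

lemma aeval_apply_eq_dist_indicator_of_eq (hconn : G.Connected) (hpos : ∀ x, 0 < ν x)
    (hν : G.adjMatrix ℝ *ᵥ ν = lam • ν)
    (hloc : IsSphereProportional G ν)
    {u u' : V} (huu' : ν u = ν u') {i : ℕ} (hex : ∃ y, G.dist u y = i)
    (hex' : ∃ y, G.dist u' y = i) {f g : ℝ[X]} (hf : f.degree = (i : WithBot ℕ))
    (hg : g.degree = (i : WithBot ℕ))
    (hfu : ∀ w, aeval (G.adjMatrix ℝ) f w u = if G.dist u w = i then 1 else 0)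
    (hgu : ∀ w, aeval (G.adjMatrix ℝ) g w u' = if G.dist u' w = i then 1 else 0) (w : V) :
    aeval (G.adjMatrix ℝ) f w u' = if G.dist u' w = i then 1 else 0 := by
  have hA : (G.adjMatrix ℝ).IsSymm := G.isSymm_adjMatrix
  have hf0 : f.leadingCoeff ≠ 0 := leadingCoeff_ne_zero.mpr fun h => by simp [h] at hf
  have hg0 : g.leadingCoeff ≠ 0 := leadingCoeff_ne_zero.mpr fun h => by simp [h] at hg
  set c := f.leadingCoeff / g.leadingCoeff with hcdef
  have hc0 : c ≠ 0 := div_ne_zero hf0 hg0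
  set h := f - C c * g with hdef
  have hh : h.degree < (i : WithBot ℕ) := by
    rw [← hf]
    refine degree_sub_lt_left ?_ (leadingCoeff_ne_zero.mp hf0) ?_
    · rw [degree_C_mul hc0, hf, hg]
    · rw [leadingCoeff_mul, leadingCoeff_C, hcdef, div_mul_cancel₀ _ hg0]
  have horth {a : V} {p : ℝ[X]} 
      (hp : ∀ w, aeval (G.adjMatrix ℝ) p w a = if G.dist a w = i then 1 else 0) :
      aeval (G.adjMatrix ℝ) (h * p) a a = 0 := by
    rw [aeval_mul_apply_self hA]
    refine Finset.sum_eq_zero fun x _ => ?_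
    rw [hp]
    split_ifs with hx
    · rw [aeval_apply_eq_zero_of_degree_lt_dist (by rwa [hx]), zero_mul]
    · rw [mul_zero]
  have hhu' : ∀ x, aeval (G.adjMatrix ℝ) h x u' = 0 := by
    refine aeval_apply_eq_zero_of_mul_self hA ?_
    have h1 := (aeval_apply_self_eq hconn hpos hν hloc huu' (h * f)).symm.trans
      (horth hfu)
    rw [show h * h = h * f - C c * (h * g) by rw [hdef]; ring, map_sub, Matrix.sub_apply,
      aeval_C_mul_apply, h1, horth hgu, mul_zero, sub_zero]
  have hfu' (x : V) : aeval (G.adjMatrix ℝ) f x u' = c * aeval (G.adjMatrix ℝ) g x u' := by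
    have := hhu' x
    rwa [hdef, map_sub, Matrix.sub_apply, aeval_C_mul_apply, sub_eq_zero] at this
  obtain ⟨y, hy⟩ := hex
  obtain ⟨y', hy'⟩ := hex'
  have hνu (x : V) (hx : G.dist u x = i) : ν x = ν y :=
    eq_of_dist_eq hconn hpos hν hloc (u := u) rfl (hx.trans hy.symm)
  have hνu' (x : V) (hx : G.dist u' x = i) : ν x = ν y :=
    eq_of_dist_eq hconn hpos hν hloc huu'.symm (hx.trans hy.symm)
  set k := ∑ x, if G.dist u x = i then (1 : ℝ) else 0 with hk
  set k' := ∑ x, if G.dist u' x = i then (1 : ℝ) else 0 with hk'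
  have hk'0 : k' ≠ 0 := by
    refine (Finset.sum_pos' (fun x _ => ?_) ⟨y', Finset.mem_univ _, by simp [hy']⟩).ne'
    split_ifs <;> norm_num
  have hnorm : k = c ^ 2 * k' := by
    have h1 := aeval_apply_self_eq hconn hpos hν hloc huu' (f * f)
    rw [aeval_mul_apply_self hA, aeval_mul_apply_self hA] at h1
    simp only [hfu, hfu', hgu] at h1
    rw [hk, hk', Finset.mul_sum]
    convert h1 using 2 <;> split_ifs <;> ring
  have hmass : k = c * k' := by
    have h1 := sum_mul_aeval_of_eigen hA hν f u
    have h2 := sum_mul_aeval_of_eigen hA hν f u'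
    rw [huu', ← h2] at h1
    simp only [hfu, hfu', hgu] at h1
    refine mul_right_cancel₀ (hpos y).ne' ?_
    rw [hk, hk', Finset.mul_sum, Finset.sum_mul, Finset.sum_mul]
    convert h1 using 2 with x _ x _
    · split_ifs with hx
      · rw [hνu x hx]
      · simp
    · split_ifs with hx
      · rw [hνu' x hx]
      · simp
  have hc1 : c = 1 := by
    refine mul_left_cancel₀ (mul_ne_zero hc0 hk'0) ?_
    linear_combination hmass - hnorm
  rw [hfu', hc1, one_mul, hgu]

lemma exists_aeval_apply_eq_distMatrix (hconn : G.Connected)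
    (hpdr : ∀ (u : V) (e : ℕ), IsEcc G u e → IsPseudoDistRegular G (G.adjMatrix ℝ) u e)
    (hpos : ∀ x, 0 < ν x) (hν : G.adjMatrix ℝ *ᵥ ν = lam • ν)
    (hloc : IsSphereProportional G ν) (u : V) (i : ℕ) :
    ∃ p : ℝ[X], p.degree = (i : WithBot ℕ) ∧ ∀ u', ν u' = ν u → ∀ w,
      aeval (G.adjMatrix ℝ) p w u' = distMatrix G i w u' := by
  have := hconn.nonempty
  obtain ⟨e, he⟩ := exists_isEcc G u
  have hecc {u' : V} (hu' : ν u' = ν u) : IsEcc G u' e := by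
    obtain ⟨e', he'⟩ := exists_isEcc G u'
    have h1 := (hpdr u e he).1
    rw [← eSupport_eq_of_eq hconn hpos hν hloc hu', (hpdr u' e' he').1] at h1
    rwa [← Nat.succ_injective h1]
  simp only [distMatrix, Matrix.of_apply]
  rcases le_or_gt i e with hi | hi
  · obtain ⟨f, hf, hfu⟩ := exists_aeval_apply_eq_dist_indicator hconn hpos hν hloc he
      (hpdr u e he) hi
    refine ⟨f, hf, fun u' hu' w => ?_⟩
    obtain ⟨g, hg, hgu⟩ := exists_aeval_apply_eq_dist_indicator hconn hpos hν hloc (hecc hu')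
      (hpdr u' e (hecc hu')) hi
    rw [G.dist_comm]
    exact aeval_apply_eq_dist_indicator_of_eq hconn hpos hν hloc hu'.symm
      (exists_dist_eq_of_isEcc hconn he hi) (exists_dist_eq_of_isEcc hconn (hecc hu') hi) hf hg
      hfu hgu w
  · refine ⟨X ^ (i - (e + 1)) * supportPoly (G.adjMatrix ℝ) u, ?_, fun u' hu' w => ?_⟩
    · rw [degree_mul, degree_X_pow, degree_eq_natDegree (supportPoly_monic u).ne_zero,
        natDegree_supportPoly, (hpdr u e he).1]
      norm_cast
      omega
    · rw [aeval_mul_apply_eq_zero (aeval_apply_eq_zero_of_eq hconn hpos hν hloc hu'.symm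
        (aeval_supportPoly_apply G.isSymm_adjMatrix u)), if_neg]
      rw [G.dist_comm]
      exact fun h => absurd ((hecc hu').1 w) (by omega)

end SphereProportional

lemma exists_isDiam_and_ncard_spectrum {V : Type*} [Fintype V] [DecidableEq V] {G : SimpleGraph V}
    [DecidableRel G.Adj] (hconn : G.Connected)
    (hpdr : ∀ (u : V) (e : ℕ), IsEcc G u e → IsPseudoDistRegular G (G.adjMatrix ℝ) u e)
    (hspec : ∃ u, spectrum ℝ (G.adjMatrix ℝ) = eSupport (G.adjMatrix ℝ) u) :
    ∃ d, IsDiam G d ∧ (spectrum ℝ (G.adjMatrix ℝ)).ncard = d + 1 := by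
  have := hconn.nonempty
  obtain ⟨u, hu⟩ := hspec
  obtain ⟨d, hd⟩ := exists_isEcc G u
  refine ⟨d, ⟨fun v w => ?_, u, hd.2⟩, hu ▸ (hpdr u d hd).1⟩
  obtain ⟨e, he⟩ := exists_isEcc G v
  have hsub : eSupport (G.adjMatrix ℝ) v ⊆ eSupport (G.adjMatrix ℝ) u := fun θ hθ =>
    hu ▸ mem_spectrum_iff_exists_mem_eSupport.mpr ⟨v, hθ⟩
  have hle := Set.ncard_le_ncard hsub (finite_eSupport _ u)
  rw [(hpdr u d hd).1, (hpdr v e he).1] at hle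
  exact (he.1 w).trans (by omega)

/-- Fiol's theorem: a connected graph that is pseudo-distance-regular at every vertex is
distance-regular or (bipartite and) distance-biregular. -/
theorem pseudo_distance_regular_everywhere
    {V : Type*} [Fintype V] [DecidableEq V] (G : SimpleGraph V) [DecidableRel G.Adj]
    (hconn : G.Connected)
    (hpdr : ∀ (u : V) (e : ℕ), IsEcc G u e → IsPseudoDistRegular G (G.adjMatrix ℝ) u e) :
    (∃ d : ℕ, IsDiam G d ∧ IsDistRegular G (G.adjMatrix ℝ) d) ∨
      (∃ B C : Finset V, IsBipartition G B C ∧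
        ∃ d : ℕ, IsDiam G d ∧ IsDistBiregular G (G.adjMatrix ℝ) B C d) := by
  classical
  obtain ⟨lam, ν, hpos, hν⟩ := exists_pos_eigenvector hconn
  have := hconn.nonempty
  have hloc : IsSphereProportional G ν := fun u p => by
    obtain ⟨e, he⟩ := exists_isEcc G u
    exact exists_aeval_apply_eq_mul_pos_eigenvector hconn hpos hν he (hpdr u e he) p
  obtain ⟨d, hdiam, hcard⟩ := exists_isDiam_and_ncard_spectrum hconn hpdr
    (exists_spectrum_eq_eSupport hconn hpos hν hloc)
  have hpoly := exists_aeval_apply_eq_distMatrix hconn hpdr hpos hν hloc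
  by_cases hedge : ∀ u w, G.Adj u w → ν w = ν u
  · have u := hconn.nonempty.some
    have hconst (w : V) : ν w = ν u := by
      induction (hconn.preconnected w u).some with
      | nil => rfl
      | cons hadj _ ih => rw [← ih, hedge _ _ hadj]
    refine Or.inl ⟨d, hdiam, hcard, fun i _ => ?_⟩
    obtain ⟨p, hdeg, hp⟩ := hpoly u i
    exact ⟨p, hdeg, Matrix.ext fun w u' => hp u' (hconst u') w⟩
  · push Not at hedge
    obtain ⟨b, c, hbc, hne⟩ := hedge
    have hnbr {x y x' y' : V} := eq_of_adj_of_eq hconn hpos hν hloc (u := x) (w := y) (u' := x')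
      (w' := y')
    have htwo (x : V) : ν x = ν b ∨ ν x = ν c := by
      have key : ∀ {a y : V}, G.Walk a y → ν a = ν b ∨ ν a = ν c → ν y = ν b ∨ ν y = ν c := by
        intro a y p
        induction p with
        | nil => exact id
        | cons hadj _ ih =>
          exact fun h => ih (h.symm.imp (hnbr · hadj hbc.symm) (hnbr · hadj hbc))
      exact key (hconn.preconnected b x).some (Or.inl rfl)
    refine Or.inr ⟨Finset.univ.filter (ν · = ν b), Finset.univ.filter (ν · = ν c),
      ⟨?_, ?_, ?_⟩, d, hdiam, hcard, ?_⟩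
    · simpa using htwo
    · simp only [Finset.mem_filter, Finset.mem_univ, true_and]
      exact fun v hv => hne (hv.2.symm.trans hv.1)
    · simp only [Finset.mem_filter, Finset.mem_univ, true_and]
      exact fun x y hxy => (htwo x).imp (fun h => ⟨h, hnbr h hxy hbc⟩)
        fun h => ⟨h, hnbr h hxy hbc.symm⟩
    · choose pB hB hB' using hpoly b
      choose pC hC hC' using hpoly c
      refine ⟨pB, pC, fun i _ => ⟨hB i, hC i, fun x hx => ?_, fun x hx => ?_⟩⟩ <;>
        rw [Matrix.mulVec_single_one, Matrix.mulVec_single_one]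
      · exact funext fun w => hB' i x (by simpa using hx) w
      · exact funext fun w => hC' i x (by simpa using hx) w
end

section
/- Let G be a finite simple connected graph with adjacency matrix A and let u be a vertex of eccentricity e. Then u is locally distance-regular (i.e. for each 0 ≤ i ≤ e there exist real numbers b_{i−1}, a_i, c_{i+1} such that every vertex v satisfies: the number of neighbors w of v with d(u,w) = i equals b_{i−1} when d(u,v) = i−1, equals a_i when d(u,v) = i, and equals c_{i+1} when d(u,v) = i+1) if and only if |Φ_u| = e+1 and there exists a sequence of real polynomials p_0, …, p_e, pairwise orthogonal with respect to ⟨·,·⟩_u and with deg p_i = i, such that p_i(A) e_u = A_i e_u for all 0 ≤ i ≤ e. -/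
open Polynomial Matrix

/-- The `u`-local inner product of polynomials: `⟨p, q⟩_u = e_uᵀ p(A) q(A) e_u`. -/
noncomputable def localIP {V : Type*} [Fintype V] [DecidableEq V] (A : Matrix V V ℝ)
    (u : V) (p q : Polynomial ℝ) : ℝ :=
  (aeval A (p * q)) u u

theorem Matrix.IsSymm.aeval {V : Type*} [Fintype V] [DecidableEq V] {A : Matrix V V ℝ}
    (hA : A.IsSymm) (p : ℝ[X]) : (aeval A p).IsSymm := by
  induction p using Polynomial.induction_on' with
  | add p q hp hq => simpa using hp.add hq
  | monomial n a => simpa [aeval_monomial, ← Algebra.smul_def] using (hA.pow n).smul a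

theorem aeval_mulVec_of_eigenvector {V : Type*} [Fintype V] [DecidableEq V] {A : Matrix V V ℝ}
    {w : V → ℝ} {θ : ℝ} (hw : A *ᵥ w = θ • w) (p : ℝ[X]) :
    aeval A p *ᵥ w = p.eval θ • w := by
  induction p using Polynomial.induction_on with
  | C a => simp [Algebra.algebraMap_eq_smul_one, smul_mulVec]
  | add p q hp hq => simp [add_mulVec, add_smul, hp, hq]
  | monomial n a h =>
    rw [pow_succ, ← mul_assoc, map_mul, aeval_X, ← mulVec_mulVec, hw, mulVec_smul, h, smul_smul]
    simp only [eval_mul, eval_X]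
    ring_nf

theorem Matrix.IsSymm.dotProduct_mulVec_comm {V : Type*} [Fintype V] {M : Matrix V V ℝ}
    (hM : M.IsSymm) (x y : V → ℝ) : x ⬝ᵥ M *ᵥ y = (M *ᵥ x) ⬝ᵥ y := by
  rw [dotProduct_mulVec, ← mulVec_transpose, hM.eq]

/-- A polynomial in `A` annihilates `e_u` exactly when it vanishes on the eigenvalue support. -/
theorem aeval_mulVec_single_eq_zero_iff {V : Type*} [Fintype V] [DecidableEq V]
    {A : Matrix V V ℝ} (hA : A.IsSymm) (u : V) (p : ℝ[X]) :
    aeval A p *ᵥ Pi.single u 1 = 0 ↔ ∀ θ ∈ eSupport A u, p.eval θ = 0 := by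
  have key (w : V → ℝ) (θ : ℝ) (hw : A *ᵥ w = θ • w) :
      w ⬝ᵥ aeval A p *ᵥ Pi.single u 1 = p.eval θ * w u := by
    rw [(hA.aeval p).dotProduct_mulVec_comm, aeval_mulVec_of_eigenvector hw, smul_dotProduct,
      dotProduct_single_one, smul_eq_mul]
  constructor
  · rintro h θ ⟨w, hw, hwu⟩
    have := key w θ hw
    rw [h, dotProduct_zero] at this
    exact (mul_eq_zero.1 this.symm).resolve_right hwu
  · intro h
    have hH : A.IsHermitian := by rw [Matrix.IsHermitian, conjTranspose_eq_transpose_of_trivial, hA.eq]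
    have h0 : WithLp.toLp 2 (aeval A p *ᵥ Pi.single u 1) = 0 := by
      refine InnerProductSpace.ext_inner_left_basis hH.eigenvectorBasis.toBasis fun j => ?_
      rw [inner_zero_right, OrthonormalBasis.coe_toBasis, EuclideanSpace.inner_eq_star_dotProduct,
        dotProduct_comm, star_trivial, key _ _ (hH.mulVec_eigenvectorBasis j)]
      by_cases hu : hH.eigenvectorBasis j u = 0
      · rw [hu, mul_zero]
      · rw [h _ ⟨_, hH.mulVec_eigenvectorBasis j, hu⟩, zero_mul]
    simpa using h0

theorem localIP_eq_dotProduct {V : Type*} [Fintype V] [DecidableEq V] {A : Matrix V V ℝ}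
    (hA : A.IsSymm) (u : V) (p q : ℝ[X]) :
    localIP A u p q = (aeval A p *ᵥ Pi.single u 1) ⬝ᵥ (aeval A q *ᵥ Pi.single u 1) := by
  rw [← (hA.aeval p).dotProduct_mulVec_comm, mulVec_mulVec, ← map_mul, single_one_dotProduct]
  simp [localIP]

theorem distMatrix_mulVec_single {V : Type*} [Fintype V] [DecidableEq V] (G : SimpleGraph V)
    (u : V) (i : ℕ) (v : V) :
    (distMatrix G i *ᵥ Pi.single u 1) v = if G.dist u v = i then 1 else 0 := by
  simp [distMatrix, G.dist_comm (u := v)]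

theorem adjMatrix_mulVec_distMatrix {V : Type*} [Fintype V] [DecidableEq V] (G : SimpleGraph V)
    [DecidableRel G.Adj] (u : V) (i : ℕ) (v : V) :
    (G.adjMatrix ℝ *ᵥ (distMatrix G i *ᵥ Pi.single u 1)) v =
      ((Finset.univ.filter fun w => G.Adj v w ∧ G.dist u w = i).card : ℝ) := by
  rw [SimpleGraph.adjMatrix_mulVec_apply]
  simp only [distMatrix_mulVec_single, Finset.sum_boole, SimpleGraph.neighborFinset_eq_filter,
    Finset.filter_filter]

theorem SimpleGraph.Connected.exists_adj_dist_eq {V : Type*} {G : SimpleGraph V}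
    (hconn : G.Connected) {u v : V} {n : ℕ} (h : G.dist u v = n + 1) :
    ∃ w, G.Adj v w ∧ G.dist u w = n := by
  obtain ⟨p, hp⟩ := hconn.exists_walk_length_eq_dist v u
  rw [G.dist_comm, h] at hp
  cases p with
  | nil => simp at hp
  | @cons _ w _ hadj p =>
    refine ⟨w, hadj, ?_⟩
    have h1 := SimpleGraph.dist_le p
    rw [SimpleGraph.Walk.length_cons] at hp
    rw [G.dist_comm] at h1
    have h2 := hadj.diff_dist_adj (u := u)
    omega

theorem SimpleGraph.Connected.exists_dist_eq_of_le {V : Type*} {G : SimpleGraph V}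
    (hconn : G.Connected) {u v : V} {k : ℕ} (h : k ≤ G.dist u v) : ∃ w, G.dist u w = k := by
  induction h using Nat.decreasingInduction with
  | self => exact ⟨v, rfl⟩
  | of_succ k _ ih =>
    obtain ⟨w, hw⟩ := ih
    obtain ⟨x, -, hx⟩ := hconn.exists_adj_dist_eq hw
    exact ⟨x, hx⟩

theorem aeval_adjMatrix_mulVec_single_ne_zero {V : Type*} [Fintype V] [DecidableEq V]
    {G : SimpleGraph V} [DecidableRel G.Adj] (hconn : G.Connected) {u v : V} {q : ℝ[X]}
    (hq : q ≠ 0) (hv : G.dist u v = q.natDegree) :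
    (aeval (G.adjMatrix ℝ) q *ᵥ Pi.single u 1) v ≠ 0 := by
  have hsmall : ∀ k ∈ Finset.range q.natDegree,
      (q.coeff k • G.adjMatrix ℝ ^ k) v u = 0 := by
    intro k hk
    rw [Finset.mem_range] at hk
    rw [Matrix.smul_apply, SimpleGraph.adjMatrix_pow_apply_eq_card_walk, Fintype.card_eq_zero_iff.2,
      Nat.cast_zero, smul_zero]
    refine ⟨fun ⟨p, hp⟩ => ?_⟩
    have h1 := SimpleGraph.dist_le p
    rw [G.dist_comm] at h1
    rw [Set.mem_ofPred_eq] at hp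
    omega
  rw [mulVec_single_one, Matrix.col_apply, aeval_eq_sum_range, Matrix.sum_apply,
    Finset.sum_range_succ, Finset.sum_eq_zero hsmall, zero_add, Matrix.smul_apply, smul_eq_mul,
    SimpleGraph.adjMatrix_pow_apply_eq_card_walk]
  refine mul_ne_zero (leadingCoeff_ne_zero.2 hq) (Nat.cast_ne_zero.2 ?_)
  obtain ⟨p, hp⟩ := hconn.exists_walk_length_eq_dist v u
  rw [G.dist_comm, hv] at hp
  exact (Fintype.card_pos_iff.2 ⟨⟨p, hp⟩⟩).ne'

/-- A polynomial annihilating `e_u` has degree larger than the eccentricity of `u`. -/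
theorem IsEcc.lt_natDegree {V : Type*} [Fintype V] [DecidableEq V]
    {G : SimpleGraph V} [DecidableRel G.Adj] (hconn : G.Connected) {u : V} {e : ℕ}
    (hecc : IsEcc G u e) {q : ℝ[X]} (hq : q ≠ 0)
    (h : aeval (G.adjMatrix ℝ) q *ᵥ Pi.single u 1 = 0) : e < q.natDegree := by
  by_contra! hle
  obtain ⟨v, rfl⟩ := hecc.2
  obtain ⟨w, hw⟩ := hconn.exists_dist_eq_of_le hle
  exact aeval_adjMatrix_mulVec_single_ne_zero hconn hq hw (congrFun h w)

theorem eval_prod_X_sub_C_eq_zero_iff (s : Finset ℝ) (θ : ℝ) :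
    (∏ x ∈ s, (X - C x)).eval θ = 0 ↔ θ ∈ s := by
  simp [eval_prod, Finset.prod_eq_zero_iff, sub_eq_zero]

/-- Polynomials of degree at most `e` applied to `e_u` are constant on spheres around `u`. -/
theorem aeval_mulVec_single_eq_of_degree_lt {V : Type*} [Fintype V] [DecidableEq V]
    {G : SimpleGraph V} {A : Matrix V V ℝ} {u : V} {e : ℕ} {p : ℕ → ℝ[X]}
    (hdeg : ∀ i ≤ e, (p i).degree = (i : WithBot ℕ))
    (hp : ∀ i ≤ e, aeval A (p i) *ᵥ Pi.single u 1 = distMatrix G i *ᵥ Pi.single u 1)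
    {n : ℕ} (hn : n ≤ e + 1) {q : ℝ[X]} (hq : q.degree < n) :
    ∃ f : ℕ → ℝ, ∀ v, (aeval A q *ᵥ Pi.single u 1) v = f (G.dist u v) := by
  induction n generalizing q with
  | zero =>
    have : q = 0 := by simpa using hq
    exact ⟨0, by simp [this]⟩
  | succ n ih =>
    have hne : (p n).coeff n ≠ 0 := coeff_ne_zero_of_eq_degree (hdeg n (by omega))
    obtain ⟨f, hf⟩ := ih (q := q - C (q.coeff n / (p n).coeff n) * p n) (by omega) (by
      rw [degree_lt_iff_coeff_zero] at hq ⊢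
      intro m hm
      rcases hm.eq_or_lt with rfl | hm
      · simp [hne]
      · have h1 : (p n).coeff m = 0 :=
          coeff_eq_zero_of_degree_lt (by rw [hdeg n (by omega)]; exact_mod_cast hm)
        simp [hq m hm, h1])
    refine ⟨fun d => f d + q.coeff n / (p n).coeff n * if d = n then 1 else 0, fun v => ?_⟩
    simp only [← hf, ← distMatrix_mulVec_single, ← hp n (by omega : n ≤ e)]
    simp [Algebra.algebraMap_eq_smul_one]

/-- If the eigenvalue support has `e + 1` elements, every polynomial in `A` applied to `e_u` is
constant on spheres around `u`. -/
theorem aeval_mulVec_single_eq_of_ncard_eSupport {V : Type*} [Fintype V] [DecidableEq V]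
    {G : SimpleGraph V} {A : Matrix V V ℝ} (hA : A.IsSymm) {u : V} {e : ℕ} {p : ℕ → ℝ[X]}
    (hcard : (eSupport A u).ncard = e + 1)
    (hdeg : ∀ i ≤ e, (p i).degree = (i : WithBot ℕ))
    (hp : ∀ i ≤ e, aeval A (p i) *ᵥ Pi.single u 1 = distMatrix G i *ᵥ Pi.single u 1)
    (q : ℝ[X]) :
    ∃ f : ℕ → ℝ, ∀ v, (aeval A q *ᵥ Pi.single u 1) v = f (G.dist u v) := by
  have hfin : (eSupport A u).Finite := Set.finite_of_ncard_ne_zero (by omega)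
  rw [Set.ncard_eq_toFinset_card _ hfin] at hcard
  set m : ℝ[X] := ∏ x ∈ hfin.toFinset, (X - C x) with hm
  have hmonic : m.Monic := monic_prod_X_sub_C _ _
  have hmdeg : m.degree = (e + 1 : ℕ) := by
    rw [degree_eq_natDegree hmonic.ne_zero, natDegree_finsetProd_X_sub_C_eq_card, hcard]
  have hm0 : aeval A m *ᵥ Pi.single u 1 = 0 :=
    (aeval_mulVec_single_eq_zero_iff hA u m).2 fun θ hθ =>
      (eval_prod_X_sub_C_eq_zero_iff _ θ).2 (hfin.mem_toFinset.2 hθ)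
  have hmod : aeval A q *ᵥ Pi.single u 1 = aeval A (q %ₘ m) *ᵥ Pi.single u 1 := by
    conv_lhs => rw [← modByMonic_add_div q m, mul_comm]
    rw [map_add, map_mul, add_mulVec, ← mulVec_mulVec, hm0, mulVec_zero, add_zero]
  rw [hmod]
  exact aeval_mulVec_single_eq_of_degree_lt hdeg hp le_rfl
    (hmdeg ▸ degree_modByMonic_lt q hmonic)

/-- Under a three-term recurrence for the sphere indicators, each of them is a polynomial in `A`
applied to `e_u`. -/
theorem exists_aeval_mulVec_single_eq_distMatrix {V : Type*} [Fintype V] [DecidableEq V]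
    {G : SimpleGraph V} (hconn : G.Connected) {A : Matrix V V ℝ} {u : V} {e : ℕ}
    (h : ∀ i ≤ e, ∃ b a c : ℝ, c ≠ 0 ∧ ∀ v, (A *ᵥ (distMatrix G i *ᵥ Pi.single u 1)) v =
      b * (if G.dist u v + 1 = i then 1 else 0) + a * (if G.dist u v = i then 1 else 0) +
        c * (if G.dist u v = i + 1 then 1 else 0)) (n : ℕ) (hn : n ≤ e + 1) :
    ∃ p : ℝ[X], p.degree = n ∧
      aeval A p *ᵥ Pi.single u 1 = distMatrix G n *ᵥ Pi.single u 1 := by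
  have step (i : ℕ) (hi : i ≤ e) (p r : ℝ[X]) (hpd : p.degree = i) (hrd : r.degree < i + 1)
      (hp : aeval A p *ᵥ Pi.single u 1 = distMatrix G i *ᵥ Pi.single u 1)
      (hr : ∀ v, (aeval A r *ᵥ Pi.single u 1) v = if G.dist u v + 1 = i then 1 else 0) :
      ∃ p : ℝ[X], p.degree = (i + 1 : ℕ) ∧
        aeval A p *ᵥ Pi.single u 1 = distMatrix G (i + 1) *ᵥ Pi.single u 1 := by
    obtain ⟨b, a, c, hc, h⟩ := h i hi
    refine ⟨C c⁻¹ * (X * p - (C a * p + C b * r)), ?_, ?_⟩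
    · have hX : (X * p).degree = ((i + 1 : ℕ) : WithBot ℕ) := by
        rw [degree_mul, degree_X, hpd, add_comm, Nat.cast_add, Nat.cast_one]
      have hlt : (C a * p + C b * r).degree < (X * p).degree := by
        rw [hX, C_mul', C_mul']
        refine (degree_add_le _ _).trans_lt (max_lt ?_ ?_)
        · refine (degree_smul_le a p).trans_lt ?_
          rw [hpd]
          exact_mod_cast Nat.lt_succ_self i
        · exact (degree_smul_le b r).trans_lt (by exact_mod_cast hrd)
      rw [degree_C_mul (inv_ne_zero hc), degree_sub_eq_left_of_degree_lt hlt, hX]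
    · ext v
      have hv := h v
      rw [← hr, ← distMatrix_mulVec_single, ← distMatrix_mulVec_single, ← hp] at hv
      simp only [map_mul, map_sub, map_add, aeval_X, aeval_C, Algebra.algebraMap_eq_smul_one,
        smul_mul_assoc, one_mul, smul_mulVec, sub_mulVec, add_mulVec, Pi.smul_apply, Pi.sub_apply,
        Pi.add_apply, smul_eq_mul, ← mulVec_mulVec, hv]
      field_simp
      ring
  induction n using Nat.strong_induction_on with
  | _ n ih =>
  match n with
  | 0 =>
    refine ⟨1, degree_one, ?_⟩
    ext v
    rw [distMatrix_mulVec_single, map_one, one_mulVec, Pi.single_apply]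
    simp only [hconn.dist_eq_zero_iff, eq_comm]
  | 1 =>
    obtain ⟨p, hpd, hp⟩ := ih 0 (by omega) (by omega)
    exact step 0 (by omega) p 0 hpd (by simp) hp (by simp)
  | n + 2 =>
    obtain ⟨p, hpd, hp⟩ := ih (n + 1) (by omega) (by omega)
    obtain ⟨r, hrd, hr⟩ := ih n (by omega) (by omega)
    refine step (n + 1) (by omega) p r hpd ?_ hp fun v => ?_
    · rw [hrd]
      exact_mod_cast (by omega : n < n + 1 + 1)
    · simp [hr, distMatrix_mulVec_single]

theorem adjMatrix_mulVec_distMatrix_recurrence {V : Type*} [Fintype V] [DecidableEq V]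
    {G : SimpleGraph V} [DecidableRel G.Adj] (hconn : G.Connected) {u : V} {i : ℕ} {b a c : ℝ}
    (h : ∀ v : V,
      (G.dist u v + 1 = i →
        ((Finset.univ.filter fun w => G.Adj v w ∧ G.dist u w = i).card : ℝ) = b) ∧
      (G.dist u v = i →
        ((Finset.univ.filter fun w => G.Adj v w ∧ G.dist u w = i).card : ℝ) = a) ∧
      (G.dist u v = i + 1 →
        ((Finset.univ.filter fun w => G.Adj v w ∧ G.dist u w = i).card : ℝ) = c)) :
    ∃ c' : ℝ, c' ≠ 0 ∧ ∀ v, (G.adjMatrix ℝ *ᵥ (distMatrix G i *ᵥ Pi.single u 1)) v =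
      b * (if G.dist u v + 1 = i then 1 else 0) + a * (if G.dist u v = i then 1 else 0) +
        c' * (if G.dist u v = i + 1 then 1 else 0) := by
  have aux (c' : ℝ) (hc' : ∀ v, G.dist u v = i + 1 → c' = c) (v : V) :
      (G.adjMatrix ℝ *ᵥ (distMatrix G i *ᵥ Pi.single u 1)) v =
      b * (if G.dist u v + 1 = i then 1 else 0) + a * (if G.dist u v = i then 1 else 0) +
        c' * (if G.dist u v = i + 1 then 1 else 0) := by
    rw [adjMatrix_mulVec_distMatrix]
    obtain ⟨h1, h2, h3⟩ := h v
    by_cases hb : G.dist u v + 1 = i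
    · rw [h1 hb]
      simp [hb, show G.dist u v ≠ i by omega, show G.dist u v ≠ i + 1 by omega]
    by_cases ha : G.dist u v = i
    · rw [h2 ha]
      simp [ha]
    by_cases hcv : G.dist u v = i + 1
    · rw [h3 hcv, hc' v hcv]
      simp [hcv, show i + 1 + 1 ≠ i by omega]
    · rw [Finset.filter_eq_empty_iff.2]
      · simp [hb, ha, hcv]
      · rintro w - ⟨hadj, hw⟩
        have := hadj.diff_dist_adj (u := u)
        omega
  by_cases hex : ∃ v, G.dist u v = i + 1
  · obtain ⟨v, hv⟩ := hex
    refine ⟨c, ?_, aux c fun _ _ => rfl⟩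
    obtain ⟨w, hadj, hw⟩ := hconn.exists_adj_dist_eq hv
    rw [← (h v).2.2 hv, Nat.cast_ne_zero]
    exact Finset.card_ne_zero_of_mem (Finset.mem_filter.2 ⟨Finset.mem_univ w, hadj, hw⟩)
  · exact ⟨1, one_ne_zero, aux 1 fun v hv => (hex ⟨v, hv⟩).elim⟩

theorem IsEcc.ncard_eSupport {V : Type*} [Fintype V] [DecidableEq V]
    {G : SimpleGraph V} [DecidableRel G.Adj] (hconn : G.Connected) {u : V} {e : ℕ}
    (hecc : IsEcc G u e) {q : ℝ[X]} (hq : q.degree = (e + 1 : ℕ))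
    (h : aeval (G.adjMatrix ℝ) q *ᵥ Pi.single u 1 = 0) :
    (eSupport (G.adjMatrix ℝ) u).ncard = e + 1 := by
  have hA : (G.adjMatrix ℝ).IsSymm := G.isSymm_adjMatrix
  have hq0 : q ≠ 0 := by
    rintro rfl
    exact WithBot.bot_ne_coe (degree_zero.symm.trans hq)
  have hsub : ∀ θ ∈ eSupport (G.adjMatrix ℝ) u, θ ∈ q.roots := fun θ hθ =>
    (mem_roots hq0).2 ((aeval_mulVec_single_eq_zero_iff hA u q).1 h θ hθ)
  have hfin : (eSupport (G.adjMatrix ℝ) u).Finite :=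
    q.roots.toFinset.finite_toSet.subset fun θ hθ => by simpa using hsub θ hθ
  rw [Set.ncard_eq_toFinset_card _ hfin]
  apply le_antisymm
  · rw [← natDegree_eq_of_degree_eq_some hq]
    exact card_le_degree_of_subset_roots fun θ hθ => hsub θ (hfin.mem_toFinset.1 hθ)
  · have := hecc.lt_natDegree hconn (monic_prod_X_sub_C id hfin.toFinset).ne_zero
      ((aeval_mulVec_single_eq_zero_iff hA u _).2 fun θ hθ =>
        (eval_prod_X_sub_C_eq_zero_iff _ θ).2 (hfin.mem_toFinset.2 hθ))
    rwa [natDegree_finsetProd_X_sub_C_eq_card] at this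

theorem locally_distance_regular_iff_orthogonal_polynomials
    {V : Type*} [Fintype V] [DecidableEq V] (G : SimpleGraph V) [DecidableRel G.Adj]
    (hconn : G.Connected) (u : V) (e : ℕ) (hecc : IsEcc G u e) :
    (∀ i ≤ e, ∃ b a c : ℝ, ∀ v : V,
      (G.dist u v + 1 = i →
        ((Finset.univ.filter fun w => G.Adj v w ∧ G.dist u w = i).card : ℝ) = b) ∧
      (G.dist u v = i →
        ((Finset.univ.filter fun w => G.Adj v w ∧ G.dist u w = i).card : ℝ) = a) ∧
      (G.dist u v = i + 1 →
        ((Finset.univ.filter fun w => G.Adj v w ∧ G.dist u w = i).card : ℝ) = c)) ↔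
    ((eSupport (G.adjMatrix ℝ) u).ncard = e + 1 ∧
      ∃ p : ℕ → Polynomial ℝ,
        (∀ i ≤ e, (p i).degree = (i : WithBot ℕ)) ∧
        (∀ i ≤ e, ∀ j ≤ e, i ≠ j → localIP (G.adjMatrix ℝ) u (p i) (p j) = 0) ∧
        (∀ i ≤ e, aeval (G.adjMatrix ℝ) (p i) *ᵥ Pi.single u 1
            = distMatrix G i *ᵥ Pi.single u 1)) := by
  have hA : (G.adjMatrix ℝ).IsSymm := G.isSymm_adjMatrix
  constructor
  · intro h
    have hex := exists_aeval_mulVec_single_eq_distMatrix hconn (A := G.adjMatrix ℝ) (u := u)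
      (e := e) fun i hi => by
        obtain ⟨b, a, c, hbac⟩ := h i hi
        exact ⟨b, a, adjMatrix_mulVec_distMatrix_recurrence hconn hbac⟩
    choose! p hdeg hp using hex
    refine ⟨hecc.ncard_eSupport hconn (hdeg (e + 1) le_rfl) ?_, p,
      fun i hi => hdeg i (by omega), fun i hi j hj hij => ?_, fun i hi => hp i (by omega)⟩
    · ext v
      have := hecc.1 v
      rw [hp (e + 1) le_rfl, distMatrix_mulVec_single, if_neg (by omega), Pi.zero_apply]
    · rw [localIP_eq_dotProduct hA, hp i (by omega), hp j (by omega)]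
      refine Finset.sum_eq_zero fun v _ => ?_
      simp only [distMatrix_mulVec_single]
      grind
  · rintro ⟨hcard, p, hdeg, -, hp⟩ i hi
    obtain ⟨f, hf⟩ := aeval_mulVec_single_eq_of_ncard_eSupport hA hcard hdeg hp (X * p i)
    have hf' (v : V) :
        ((Finset.univ.filter fun w => G.Adj v w ∧ G.dist u w = i).card : ℝ) =
          f (G.dist u v) := by
      rw [← hf, map_mul, aeval_X, ← mulVec_mulVec, hp i hi, adjMatrix_mulVec_distMatrix]
    refine ⟨f (i - 1), f i, f (i + 1), fun v => ⟨?_, ?_, ?_⟩⟩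
    · rintro rfl
      exact hf' v
    · rintro rfl
      exact hf' v
    · intro hv
      rw [hf', hv]
end

section
/- Let G be a finite simple connected bipartite graph with bipartition (B,C) and adjacency matrix A, and let θ and τ be distinct eigenvalues of A with spectral idempotents E_θ and E_τ. If (E_θ + E_τ)_{b,c} = 0 for every b ∈ B and c ∈ C, then τ = −θ. -/
open Polynomial Matrix

/-- `E` is the spectral idempotent of `A` for the eigenvalue `θ`: the (real symmetric)
orthogonal projection onto the `θ`-eigenspace of `A`. -/
def IsSpectralIdem {V : Type*} [Fintype V] [DecidableEq V] (A E : Matrix V V ℝ)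
    (θ : ℝ) : Prop :=
  E.IsSymm ∧ E * E = E ∧ A * E = θ • E ∧
    ∀ w : V → ℝ, A *ᵥ w = θ • w → E *ᵥ w = w

/-- A spectral idempotent of a symmetric matrix kills the eigenvectors of the other eigenvalues. -/
lemma IsSpectralIdem.mulVec_eq_zero {V : Type*} [Fintype V] [DecidableEq V]
    {A E : Matrix V V ℝ} {σ μ : ℝ} (hA : A.IsSymm) (hE : IsSpectralIdem A E σ)
    (hμ : μ ≠ σ) {w : V → ℝ} (hw : A *ᵥ w = μ • w) : E *ᵥ w = 0 := by
  obtain ⟨hs, -, hAE, -⟩ := hE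
  have hEA : E * A = σ • E := by
    simpa [Matrix.transpose_mul, hA.eq, hs.eq] using congrArg Matrix.transpose hAE
  have h : σ • (E *ᵥ w) = μ • (E *ᵥ w) := by
    rw [← Matrix.smul_mulVec, ← hEA, ← Matrix.mulVec_mulVec, hw, Matrix.mulVec_smul]
  have h0 : (σ - μ) • (E *ᵥ w) = 0 := by rw [sub_smul, h, sub_self]
  exact (smul_eq_zero.mp h0).resolve_left (sub_ne_zero.mpr hμ.symm)

/-- If a diagonal sign matrix `s` anticommutes with the symmetric matrix `A` and commutes with
`Eθ + Eτ`, then `-θ` is one of `θ`, `τ`. -/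
lemma IsSpectralIdem.neg_eq_or_neg_eq {V : Type*} [Fintype V] [DecidableEq V]
    {A Eθ Eτ : Matrix V V ℝ} {θ τ : ℝ} (hA : A.IsSymm) (hne : θ ≠ τ)
    (hθ : ∃ w : V → ℝ, w ≠ 0 ∧ A *ᵥ w = θ • w)
    (hEθ : IsSpectralIdem A Eθ θ) (hEτ : IsSpectralIdem A Eτ τ) {s : V → ℝ}
    (hs : ∀ v, s v ≠ 0) (hanti : ∀ u v, A u v * s v = -(s u * A u v))
    (hcomm : ∀ u v, (Eθ + Eτ) u v * s v = s u * (Eθ + Eτ) u v) :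
    -θ = θ ∨ -θ = τ := by
  obtain ⟨w, hw0, hw⟩ := hθ
  by_contra! hcon
  have hsw : A *ᵥ (s * w) = (-θ) • (s * w) := by
    funext u
    have := congrFun hw u
    simp only [Matrix.mulVec, dotProduct, Pi.smul_apply, Pi.mul_apply, smul_eq_mul] at this ⊢
    simp_rw [← mul_assoc, hanti, neg_mul, mul_assoc, Finset.sum_neg_distrib, ← Finset.mul_sum,
      this]
    ring
  have hM : (Eθ + Eτ) *ᵥ w = w := by
    rw [Matrix.add_mulVec, hEθ.2.2.2 w hw, hEτ.mulVec_eq_zero hA hne hw, add_zero]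
  have hMs : (Eθ + Eτ) *ᵥ (s * w) = 0 := by
    rw [Matrix.add_mulVec, hEθ.mulVec_eq_zero hA hcon.1 hsw, hEτ.mulVec_eq_zero hA hcon.2 hsw,
      add_zero]
  refine hw0 (funext fun u => ?_)
  have h1 := congrFun hM u
  have h2 := congrFun hMs u
  simp only [Matrix.mulVec, dotProduct, Pi.mul_apply, Pi.zero_apply] at h1 h2
  simp_rw [← mul_assoc, hcomm, mul_assoc, ← Finset.mul_sum, h1] at h2
  exact (mul_eq_zero.mp h2).resolve_left (hs u)

theorem sum_of_idempotents_zero_off_diagonal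
    {V : Type*} [Fintype V] [DecidableEq V] (G : SimpleGraph V) [DecidableRel G.Adj]
    (hconn : G.Connected) (B C : Finset V) (hbip : IsBipartition G B C)
    (θ τ : ℝ) (hne : θ ≠ τ) (Eθ Eτ : Matrix V V ℝ)
    (hθev : ∃ w : V → ℝ, w ≠ 0 ∧ G.adjMatrix ℝ *ᵥ w = θ • w)
    (hτev : ∃ w : V → ℝ, w ≠ 0 ∧ G.adjMatrix ℝ *ᵥ w = τ • w)
    (hEθ : IsSpectralIdem (G.adjMatrix ℝ) Eθ θ)
    (hEτ : IsSpectralIdem (G.adjMatrix ℝ) Eτ τ)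
    (hoff : ∀ b ∈ B, ∀ c ∈ C, (Eθ + Eτ) b c = 0) :
    τ = -θ := by
  obtain ⟨hcov, hdisj, hadj⟩ := hbip
  have hA : (G.adjMatrix ℝ).IsSymm := G.isSymm_adjMatrix
  have hBC : ∀ v, v ∈ C ↔ v ∉ B := fun v =>
    ⟨fun hc hb => hdisj v ⟨hb, hc⟩, (hcov v).resolve_left⟩
  have hoff' : ∀ c ∈ C, ∀ b ∈ B, (Eθ + Eτ) c b = 0 := fun c hc b hb => by
    rw [← (hEθ.1.add hEτ.1).apply c b]
    exact hoff b hb c hc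
  let s : V → ℝ := fun v => if v ∈ B then 1 else -1
  have hs : ∀ v, s v ≠ 0 := fun v => by
    by_cases hv : v ∈ B <;> simp [s, hv]
  have hanti : ∀ u v, G.adjMatrix ℝ u v * s v = -(s u * G.adjMatrix ℝ u v) := fun u v => by
    by_cases huv : G.Adj u v
    · rcases hadj u v huv with ⟨hu, hv⟩ | ⟨hu, hv⟩
      · simp [s, huv, hu, (hBC v).mp hv]
      · simp [s, huv, hv, (hBC u).mp hu]
    · simp [huv]
  have hcomm : ∀ u v, (Eθ + Eτ) u v * s v = s u * (Eθ + Eτ) u v := fun u v => by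
    by_cases hu : u ∈ B <;> by_cases hv : v ∈ B
    · simp only [s, hu, hv, if_true, mul_comm]
    · simp only [hoff u hu v ((hBC v).mpr hv), zero_mul, mul_zero]
    · simp only [hoff' u ((hBC u).mpr hu) v hv, zero_mul, mul_zero]
    · simp only [s, hu, hv, if_false, mul_comm]
  have hcomm' : ∀ u v, (Eτ + Eθ) u v * s v = s u * (Eτ + Eθ) u v := by
    rwa [add_comm Eτ Eθ]
  rcases hEθ.neg_eq_or_neg_eq hA hne hθev hEτ hs hanti hcomm with h | h
  · rcases hEτ.neg_eq_or_neg_eq hA hne.symm hτev hEθ hs hanti hcomm' with h' | h'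
    · exact absurd (by linarith) hne
    · linarith
  · exact h.symm
end

section
/- Let G be a finite simple connected (k,ℓ)-semiregular bipartite graph with bipartition (B,C) whose diameter d is odd and whose adjacency matrix has exactly d+1 distinct eigenvalues. Then k = ℓ, i.e. G is regular. -/
open Polynomial Matrix

/-- A finite set of reals that is closed under negation and contains `0` has odd cardinality. -/
theorem odd_ncard_of_neg_mem {s : Set ℝ} (hs : s.Finite) (hneg : ∀ x ∈ s, -x ∈ s)
    (h0 : (0 : ℝ) ∈ s) : Odd s.ncard := by
  classical
  lift s to Finset ℝ using hs
  simp only [Finset.mem_coe] at hneg h0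
  rw [Set.ncard_coe_finset, ← Finset.card_erase_add_one h0]
  refine Even.add_one ?_
  have h : ∑ x ∈ s.erase 0, (1 : ZMod 2) = 0 := by
    refine Finset.sum_involution (fun x _ => -x) (fun _ _ => by decide) ?_ ?_ ?_
    · intro x hx _ h
      exact (Finset.mem_erase.1 hx).1 (by linarith)
    · intro x hx
      have := Finset.mem_erase.1 hx
      exact Finset.mem_erase.2 ⟨neg_ne_zero.2 this.1, hneg x this.2⟩
    · simp
  rw [Finset.sum_const, nsmul_one] at h
  exact (ZMod.natCast_eq_zero_iff_even).1 h

section SignMatrix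

variable {V : Type*} [Fintype V] [DecidableEq V]

/-- The diagonal matrix with entry `1` on `B` and `-1` off `B`. -/
def signMatrix (B : Finset V) : Matrix V V ℝ :=
  Matrix.diagonal fun v => if v ∈ B then 1 else -1

theorem signMatrix_mul_self (B : Finset V) : signMatrix B * signMatrix B = 1 := by
  rw [signMatrix, Matrix.diagonal_mul_diagonal, ← Matrix.diagonal_one]
  congr 1
  ext v
  split_ifs <;> norm_num

theorem IsBipartition.adjMatrix_mul_signMatrix {G : SimpleGraph V} [DecidableRel G.Adj]
    {B C : Finset V} (h : IsBipartition G B C) :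
    G.adjMatrix ℝ * signMatrix B = -(signMatrix B * G.adjMatrix ℝ) := by
  ext u v
  rw [signMatrix, Matrix.neg_apply, Matrix.mul_diagonal, Matrix.diagonal_mul,
    SimpleGraph.adjMatrix_apply]
  by_cases huv : G.Adj u v
  · have hu := h.2.1 u
    have hv := h.2.1 v
    rcases h.2.2 u v huv with ⟨h1, h2⟩ | ⟨h1, h2⟩
    · have : v ∉ B := fun h3 => hv ⟨h3, h2⟩
      simp [huv, h1, this]
    · have : u ∉ B := fun h3 => hu ⟨h3, h1⟩
      simp [huv, h2, this]
  · simp [huv]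

theorem IsBipartition.neg_mem_spectrum {G : SimpleGraph V} [DecidableRel G.Adj]
    {B C : Finset V} (h : IsBipartition G B C) {x : ℝ}
    (hx : x ∈ spectrum ℝ (G.adjMatrix ℝ)) : -x ∈ spectrum ℝ (G.adjMatrix ℝ) := by
  let S : (Matrix V V ℝ)ˣ :=
    ⟨signMatrix B, signMatrix B, signMatrix_mul_self B, signMatrix_mul_self B⟩
  have hS : (S : Matrix V V ℝ) * G.adjMatrix ℝ * (S⁻¹ : (Matrix V V ℝ)ˣ) = -G.adjMatrix ℝ := by
    change signMatrix B * G.adjMatrix ℝ * signMatrix B = _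
    rw [mul_assoc, h.adjMatrix_mul_signMatrix, mul_neg, ← mul_assoc, signMatrix_mul_self, one_mul]
  have := spectrum.units_conjugate (R := ℝ) (a := G.adjMatrix ℝ) (u := S)
  rw [hS, ← spectrum.neg_eq] at this
  rw [← this]
  simpa using hx

theorem IsBipartition.sum_sign_mul {G : SimpleGraph V} {B C : Finset V}
    (h : IsBipartition G B C) (f : V → ℝ) :
    ∑ v, (if v ∈ B then 1 else -1) * f v = ∑ v ∈ B, f v - ∑ v ∈ C, f v := by
  have hC : C = Bᶜ := by
    ext v
    have h1 := h.1 v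
    have h2 := h.2.1 v
    rw [Finset.mem_compl]
    tauto
  rw [hC, ← Finset.sum_add_sum_compl B, sub_eq_add_neg, ← Finset.sum_neg_distrib]
  congr 1 <;> refine Finset.sum_congr rfl fun v hv => ?_
  · simp [hv]
  · simp [Finset.mem_compl.1 hv]

theorem IsBipartition.card_eq_of_isUnit {G : SimpleGraph V} [DecidableRel G.Adj]
    {B C : Finset V} (h : IsBipartition G B C) (hA : IsUnit (G.adjMatrix ℝ)) :
    B.card = C.card := by
  obtain ⟨A, hA⟩ := hA
  have hAS := h.adjMatrix_mul_signMatrix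
  rw [← hA] at hAS
  have htr : (signMatrix B).trace = -(signMatrix B).trace := by
    have := congrArg (fun M : Matrix V V ℝ => Matrix.trace (M * ((A⁻¹ : (Matrix V V ℝ)ˣ) : Matrix V V ℝ))) hAS
    simpa only [neg_mul, Matrix.trace_neg, Units.mul_inv_cancel_right,
      Matrix.trace_mul_cycle (A : Matrix V V ℝ), Units.inv_mul, one_mul] using this
  have hs := h.sum_sign_mul fun _ => 1
  have ht : (signMatrix B).trace = ∑ v, (if v ∈ B then (1 : ℝ) else -1) * 1 := by
    simp only [signMatrix, Matrix.trace_diagonal, mul_one]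
  rw [hs] at ht
  simp only [Finset.sum_const, nsmul_one] at ht
  have : (B.card : ℝ) = C.card := by linarith
  exact_mod_cast this

theorem IsBipartition.sum_degree_eq {G : SimpleGraph V} [DecidableRel G.Adj]
    {B C : Finset V} (h : IsBipartition G B C) :
    ∑ v ∈ B, G.degree v = ∑ v ∈ C, G.degree v := by
  have h1 : ∑ u, ∑ v, (G.adjMatrix ℝ * signMatrix B) u v =
      ∑ v, (if v ∈ B then 1 else -1) * (G.degree v : ℝ) := by
    refine Finset.sum_comm.trans (Finset.sum_congr rfl fun v _ => ?_)
    simp only [signMatrix, Matrix.mul_diagonal]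
    rw [← Finset.sum_mul, mul_comm]
    congr 1
    simp [SimpleGraph.adjMatrix_apply, G.adj_comm _ v, ← SimpleGraph.card_neighborFinset_eq_degree,
      SimpleGraph.neighborFinset_eq_filter]
  have h2 : ∑ u, ∑ v, (signMatrix B * G.adjMatrix ℝ) u v =
      ∑ v, (if v ∈ B then 1 else -1) * (G.degree v : ℝ) := by
    refine Finset.sum_congr rfl fun v _ => ?_
    simp only [signMatrix, Matrix.diagonal_mul]
    rw [← Finset.mul_sum]
    congr 1
    simp [SimpleGraph.adjMatrix_apply, ← SimpleGraph.card_neighborFinset_eq_degree,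
      SimpleGraph.neighborFinset_eq_filter]
  rw [h.adjMatrix_mul_signMatrix] at h1
  simp only [Matrix.neg_apply, Finset.sum_neg_distrib] at h1
  rw [h2, h.sum_sign_mul] at h1
  have : ∑ v ∈ B, (G.degree v : ℝ) = ∑ v ∈ C, (G.degree v : ℝ) := by linarith
  exact_mod_cast this

end SignMatrix

/-- A semiregular bipartite graph of odd diameter `d` with `d + 1` distinct eigenvalues
is regular. -/
theorem semiregular_odd_diameter_is_regular
    {V : Type*} [Fintype V] [DecidableEq V] (G : SimpleGraph V) [DecidableRel G.Adj]
    (hconn : G.Connected) (B C : Finset V) (hbip : IsBipartition G B C)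
    (k ℓ : ℕ) (hkB : ∀ b ∈ B, G.degree b = k) (hlC : ∀ c ∈ C, G.degree c = ℓ)
    (d : ℕ) (hodd : Odd d) (hd : IsDiam G d)
    (hspec : (spectrum ℝ (G.adjMatrix ℝ)).ncard = d + 1) :
    k = ℓ := by
  have hA : IsUnit (G.adjMatrix ℝ) := by
    by_contra hA
    refine Nat.not_odd_iff_even.2 hodd.add_one (hspec ▸ odd_ncard_of_neg_mem
      (Set.finite_of_ncard_pos (by omega)) (fun x hx => hbip.neg_mem_spectrum hx) ?_)
    exact (spectrum.zero_mem_iff ℝ).2 hA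
  have hcard := hbip.card_eq_of_isUnit hA
  have hsum := hbip.sum_degree_eq
  rw [Finset.sum_congr rfl hkB, Finset.sum_congr rfl hlC, Finset.sum_const, Finset.sum_const,
    smul_eq_mul, smul_eq_mul, hcard] at hsum
  refine Nat.eq_of_mul_eq_mul_left ?_ hsum
  obtain ⟨v⟩ := hconn.nonempty
  rcases hbip.1 v with hv | hv
  · exact hcard ▸ Finset.card_pos.2 ⟨v, hv⟩
  · exact Finset.card_pos.2 ⟨v, hv⟩
end

section
/- Let G be a finite simple bipartite graph with bipartition (B,C) and adjacency matrix A, and let θ be a nonzero eigenvalue of A with spectral idempotent E_θ. Then Σ_{b∈B} (E_θ)_{b,b} = Σ_{c∈C} (E_θ)_{c,c} = (1/2)·tr(E_θ). -/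
open Polynomial Matrix

/-- If a matrix `D` anticommutes with `A` and `E` satisfies `A * E = θ • E = E * A` with `θ ≠ 0`,
then `D * E` is traceless. -/
theorem trace_mul_eq_zero_of_anticommute {V : Type*} [Fintype V] {A D E : Matrix V V ℝ} {θ : ℝ}
    (hθ : θ ≠ 0) (hDA : D * A = -(A * D)) (hAE : A * E = θ • E) (hEA : E * A = θ • E) :
    Matrix.trace (D * E) = 0 := by
  have h : θ * Matrix.trace (D * E) = -(θ * Matrix.trace (D * E)) := by
    calc θ * Matrix.trace (D * E) = Matrix.trace (D * (A * E)) := by simp [hAE]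
      _ = -Matrix.trace (A * (D * E)) := by
        rw [← Matrix.mul_assoc, hDA, Matrix.neg_mul, Matrix.trace_neg, Matrix.mul_assoc]
      _ = -Matrix.trace (D * (E * A)) := by rw [Matrix.trace_mul_comm A, Matrix.mul_assoc]
      _ = -(θ * Matrix.trace (D * E)) := by simp [hEA]
  exact (mul_eq_zero.mp (by linarith)).resolve_left hθ

/-- The signed indicator of a bipartition anticommutes with the adjacency matrix. -/
theorem IsBipartition.diagonal_mul_adjMatrix {V : Type*} [Fintype V] [DecidableEq V]
    {G : SimpleGraph V} [DecidableRel G.Adj] {B C : Finset V} (h : IsBipartition G B C) :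
    Matrix.diagonal (fun v => if v ∈ B then (1 : ℝ) else -1) * G.adjMatrix ℝ =
      -(G.adjMatrix ℝ * Matrix.diagonal (fun v => if v ∈ B then (1 : ℝ) else -1)) := by
  ext u v
  rw [Matrix.neg_apply, Matrix.diagonal_mul, Matrix.mul_diagonal, SimpleGraph.adjMatrix_apply]
  by_cases huv : G.Adj u v
  · rcases h.2.2 u v huv with ⟨hu, hv⟩ | ⟨hu, hv⟩
    · have hv' : v ∉ B := fun hB => h.2.1 v ⟨hB, hv⟩
      simp [huv, hu, hv']
    · have hu' : u ∉ B := fun hB => h.2.1 u ⟨hB, hu⟩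
      simp [huv, hu', hv]
  · simp [huv]

/-- For a nonzero eigenvalue of a bipartite graph, the diagonal of the spectral idempotent
has equal total weight on the two parts, each half the trace. -/
theorem idempotent_diagonal_split_evenly
    {V : Type*} [Fintype V] [DecidableEq V] (G : SimpleGraph V) [DecidableRel G.Adj]
    (B C : Finset V) (hbip : IsBipartition G B C)
    (θ : ℝ) (hθ : θ ≠ 0) (E : Matrix V V ℝ)
    (hev : ∃ w : V → ℝ, w ≠ 0 ∧ G.adjMatrix ℝ *ᵥ w = θ • w)
    (hE : IsSpectralIdem (G.adjMatrix ℝ) E θ) :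
    (∑ b ∈ B, E b b) = ∑ c ∈ C, E c c ∧ (∑ c ∈ C, E c c) = (1 / 2) * Matrix.trace E := by
  obtain ⟨hsymm, -, hAE, -⟩ := hE
  have hEA : E * G.adjMatrix ℝ = θ • E := by
    have h := congrArg Matrix.transpose hAE
    rwa [Matrix.transpose_mul, Matrix.transpose_smul, hsymm.eq,
      SimpleGraph.transpose_adjMatrix] at h
  have hzero := trace_mul_eq_zero_of_anticommute hθ hbip.diagonal_mul_adjMatrix hAE hEA
  have hC : C = Bᶜ := by
    ext v
    have h₁ := hbip.1 v
    have h₂ := hbip.2.1 v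
    rw [Finset.mem_compl]
    tauto
  have htrace : Matrix.trace E = ∑ b ∈ B, E b b + ∑ c ∈ C, E c c := by
    rw [hC, Finset.sum_add_sum_compl]
    rfl
  have hdiff : ∑ b ∈ B, E b b - ∑ c ∈ C, E c c = 0 := by
    rw [← hzero, Matrix.trace, ← Finset.sum_add_sum_compl B, hC, sub_eq_add_neg,
      ← Finset.sum_neg_distrib]
    congr 1
    · refine Finset.sum_congr rfl fun v hv => ?_
      simp [Matrix.diagonal_mul, hv]
    · refine Finset.sum_congr rfl fun v hv => ?_
      simp [Matrix.diagonal_mul, Finset.mem_compl.mp hv]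
  constructor <;> linarith
end
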